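/- arXiv:2206.05801 — 3 statements merged into one kernel-verified Lean document; each statement's English description precedes it below -/
import Mathlib

section
/- Let p be a prime and F a finite extension of Q_p containing a primitive p-th root of unity ζ_p. If a ∈ O_F and the element 1 + (1−ζ_p)^p · a is a p-th power in F, then the polynomial x^p − x − ā has a root in the residue field O_F/M_F, where ā denotes the image of a in the residue field. -/
open Polynomial in
/-- Let `F/ℚ_p` be finite with a primitive `p`-th root of unity `ζ`.
If `a ∈ O_F` and `1 + (1 - ζ)^p * a` is a `p`-th power in `F`, then `X^p - X - ā` has a root
in the residue field `O_F / M_F`. -/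
theorem stmt5 (p : ℕ) [Fact p.Prime] (F : Type) [Field F] [Algebra ℚ_[p] F]
    [FiniteDimensional ℚ_[p] F] [Algebra ℤ_[p] F] [IsScalarTower ℤ_[p] ℚ_[p] F]
    (ζ : F) (hζ : IsPrimitiveRoot ζ p)
    (a : integralClosure ℤ_[p] F)
    (h : ∃ y : F, y ^ p = 1 + (1 - ζ) ^ p * (a : F))
    (M : Ideal (integralClosure ℤ_[p] F)) (hM : M.IsMaximal) :
    ∃ x : integralClosure ℤ_[p] F ⧸ M,
      x ^ p - x - Ideal.Quotient.mk M a = 0 := by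
  have hp : p.Prime := Fact.out
  obtain ⟨y, hy⟩ := h
  obtain ⟨n, hn⟩ : ∃ n, p = n + 1 := ⟨p - 1, by have := hp.pos; omega⟩
  have hn1 : 1 ≤ n := by have := hp.two_le; omega
  have hζint : IsIntegral ℤ_[p] ζ := hζ.isIntegral hp.pos |>.tower_top
  let Z : integralClosure ℤ_[p] F := ⟨ζ, hζint⟩
  have hZ : (Z : F) = ζ := rfl
  let W : integralClosure ℤ_[p] F :=
    ∏ k ∈ Finset.range n, ∑ i ∈ Finset.range (k + 1), Z ^ i
  have hW : (p : F) = (1 - ζ) ^ n * (W : F) := by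
    have h1 := IsPrimitiveRoot.prod_one_sub_pow_eq_order (n := n) (μ := ζ) (hn ▸ hζ)
    have h2 : (p : F) = n + 1 := by rw [hn]; push_cast; rfl
    rw [h2, ← h1]
    have h3 : (W : F) = ∏ k ∈ Finset.range n, ∑ i ∈ Finset.range (k + 1), ζ ^ i := by
      simp [W, hZ]
    have h4 : (1 - ζ) ^ n = ∏ k ∈ Finset.range n, (1 - ζ) := by simp
    rw [h3, h4, ← Finset.prod_mul_distrib]
    refine Finset.prod_congr rfl fun k _ => ?_
    rw [mul_neg_geom_sum]
  have hπ : (1 - ζ) ≠ 0 := sub_ne_zero.mpr (hζ.ne_one hp.one_lt).symm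
  obtain ⟨z, hz⟩ : ∃ z : F, y = (1 - ζ) * z + 1 :=
    ⟨(y - 1) / (1 - ζ), by field_simp; ring⟩
  -- the key equation
  have key : z ^ p + ∑ k ∈ Finset.range n,
      (W : F) * ((p.choose (k + 1) / p : ℕ) : F) * (1 - ζ) ^ k * z ^ (k + 1) = a := by
    have h1 : (1 - ζ) ^ p * (z ^ p + ∑ k ∈ Finset.range n,
      (W : F) * ((p.choose (k + 1) / p : ℕ) : F) * (1 - ζ) ^ k * z ^ (k + 1))
        = (1 - ζ) ^ p * a := by
      have h2 : (1 - ζ) ^ p * (a : F) = y ^ p - 1 := by rw [hy]; ring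
      rw [h2, hz, add_pow, Finset.sum_range_succ]
      have h3 : Finset.range p = Finset.range (n + 1) := by rw [hn]
      rw [h3, Finset.sum_range_succ', mul_add, Finset.mul_sum]
      have h4 : ∀ k ∈ Finset.range n, (1 - ζ) ^ p * ((W : F) * ((p.choose (k + 1) / p : ℕ) : F)
          * (1 - ζ) ^ k * z ^ (k + 1)) =
          ((1 - ζ) * z) ^ (k + 1) * 1 ^ (p - (k + 1)) * (p.choose (k + 1) : F) := by
        intro k hk
        have hk' := Finset.mem_range.mp hk
        have h5 : p.choose (k + 1) = p * (p.choose (k + 1) / p) :=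
          (Nat.mul_div_cancel' (hp.dvd_choose_self (by omega) (by omega))).symm
        have h6 : (p.choose (k + 1) : F) = (p : F) * ((p.choose (k + 1) / p : ℕ) : F) := by
          exact_mod_cast congrArg (Nat.cast (R := F)) h5
        have h7 : (1 - ζ) ^ p = (1 - ζ) ^ n * (1 - ζ) := by
          rw [← pow_succ, ← hn]
        rw [h6, hW, h7, mul_pow]
        ring
      rw [Finset.sum_congr rfl h4]
      simp [mul_pow]
      ring
    exact mul_left_cancel₀ (pow_ne_zero _ hπ) h1
  have hzint : IsIntegral ℤ_[p] z := by
    have : IsIntegral (integralClosure ℤ_[p] F) z := by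
      let q : (integralClosure ℤ_[p] F)[X] := ∑ k ∈ Finset.range n,
        C (W * ((p.choose (k + 1) / p : ℕ) : integralClosure ℤ_[p] F) * (1 - Z) ^ k) * X ^ (k + 1)
          - C a
      have hq : q.degree < (p : WithBot ℕ) := by
        refine lt_of_le_of_lt (degree_sub_le _ _) (max_lt ?_ ?_)
        · refine lt_of_le_of_lt (b := (n : WithBot ℕ)) ?_ (by exact_mod_cast (by omega : n < p))
          refine (degree_sum_le _ _).trans (Finset.sup_le fun k hk => ?_)
          refine (degree_C_mul_X_pow_le _ _).trans ?_
          have := Finset.mem_range.mp hk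
          exact_mod_cast this
        · exact lt_of_le_of_lt degree_C_le (by exact_mod_cast hp.pos)
      refine ⟨X ^ p + q, monic_X_pow_add hq, ?_⟩
      have h8 : ∀ x : integralClosure ℤ_[p] F,
        algebraMap (integralClosure ℤ_[p] F) F x = (x : F) := fun _ => rfl
      simp only [q, eval₂_add, eval₂_sub, eval₂_finsetSum, eval₂_mul, eval₂_C, eval₂_X_pow]
      simp only [map_mul, map_pow, map_natCast, map_sub, map_one]
      simp only [h8, hZ]
      rw [← key]; ring
    exact isIntegral_trans z this
  let z' : integralClosure ℤ_[p] F := ⟨z, hzint⟩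
  have key' : z' ^ p + ∑ k ∈ Finset.range n,
      W * ((p.choose (k + 1) / p : ℕ) : integralClosure ℤ_[p] F) * (1 - Z) ^ k * z' ^ (k + 1)
        = a := by
    apply Subtype.ext
    rw [← key]
    simp [z', hZ]
  have hpM : (p : integralClosure ℤ_[p] F) ∈ M := by
    have hmax : (M.comap (algebraMap ℤ_[p] (integralClosure ℤ_[p] F))).IsMaximal :=
      Ideal.isMaximal_comap_of_isIntegral_of_isMaximal M
    have h9 := IsLocalRing.eq_maximalIdeal hmax
    have h10 : (p : ℤ_[p]) ∈ M.comap (algebraMap ℤ_[p] (integralClosure ℤ_[p] F)) := by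
      rw [h9, PadicInt.maximalIdeal_eq_span_p]
      exact Ideal.mem_span_singleton_self _
    simpa using h10
  let _ : Field (integralClosure ℤ_[p] F ⧸ M) := Ideal.Quotient.field M
  have hp0 : ((p : ℕ) : integralClosure ℤ_[p] F ⧸ M) = 0 := by
    have := Ideal.Quotient.eq_zero_iff_mem.mpr hpM
    simpa using this
  have : CharP (integralClosure ℤ_[p] F ⧸ M) p :=
    (CharP.charP_iff_prime_eq_zero hp).mpr hp0
  have hZ1 : Ideal.Quotient.mk M Z = 1 := by
    have h11 : Z ^ p = 1 := Subtype.ext (by simpa [hZ] using hζ.pow_eq_one)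
    have h12 : (Ideal.Quotient.mk M Z - 1) ^ p = 0 := by
      rw [sub_pow_char, ← map_pow, h11]; simp
    exact sub_eq_zero.mp (pow_eq_zero_iff hp.ne_zero |>.mp h12)
  have hW1 : Ideal.Quotient.mk M W = -1 := by
    have h13 : Ideal.Quotient.mk M W = ((n.factorial : ℕ) : integralClosure ℤ_[p] F ⧸ M) := by
      simp [W, hZ1, ← Finset.prod_range_add_one_eq_factorial]
    have h14 := ZMod.wilsons_lemma p
    have h15 := congrArg (ZMod.castHom (dvd_refl p) (integralClosure ℤ_[p] F ⧸ M)) h14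
    rw [h13]
    have h16 : p - 1 = n := by omega
    rw [h16] at h15
    simpa only [map_natCast, map_neg, map_one] using h15
  refine ⟨Ideal.Quotient.mk M z', ?_⟩
  have key2 := congrArg (Ideal.Quotient.mk M) key'
  rw [← key2]
  simp only [map_add, map_sum, map_mul, map_pow, map_natCast, map_sub, map_one, hZ1, hW1, sub_self]
  rw [Finset.sum_eq_single 0]
  · simp [Nat.div_self hp.pos]
    ring
  · intro k _ hk; simp [hk]
  · intro h0; exact absurd (Finset.mem_range.mpr hn1) h0
end

section
/- Let p be an odd prime and K = Q_p(ζ_p). The compositum of all degree-p extensions F of K (inside a fixed algebraic closure of Q_p) such that F/Q_p is abelian Galois equals Q_p(ζ_{p^2}, ζ_{p^p−1}); in particular, every such F is contained in Q_p(ζ_{p^2}, ζ_{p^p−1}), and Gal(Q_p(ζ_{p^2}, ζ_{p^p−1})/Q_p(ζ_p)) ≅ C_p × C_p. -/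
namespace LKW

open Polynomial

variable {p : ℕ} [hp : Fact p.Prime]

local notation "Ω" => PadicAlgCl p

/-! ### Basic facts on the norm -/

lemma norm_add_le' (x y : Ω) {r : ℝ} (hx : ‖x‖ ≤ r) (hy : ‖y‖ ≤ r) : ‖x + y‖ ≤ r :=
  (IsUltrametricDist.norm_add_le_max x y).trans (max_le hx hy)

lemma norm_sub_le' (x y : Ω) {r : ℝ} (hx : ‖x‖ ≤ r) (hy : ‖y‖ ≤ r) : ‖x - y‖ ≤ r := by
  rw [sub_eq_add_neg]
  exact norm_add_le' _ _ hx (by rwa [norm_neg])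

lemma norm_add_lt' (x y : Ω) {r : ℝ} (hx : ‖x‖ < r) (hy : ‖y‖ < r) : ‖x + y‖ < r :=
  (IsUltrametricDist.norm_add_le_max x y).trans_lt (max_lt hx hy)

lemma norm_sub_lt' (x y : Ω) {r : ℝ} (hx : ‖x‖ < r) (hy : ‖y‖ < r) : ‖x - y‖ < r := by
  rw [sub_eq_add_neg]
  exact norm_add_lt' _ _ hx (by rwa [norm_neg])

lemma norm_aut (σ : Ω ≃ₐ[ℚ_[p]] Ω) (x : Ω) : ‖σ x‖ = ‖x‖ :=
  (spectralNorm_eq_of_equiv σ x).symm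

lemma norm_root {ζ : Ω} {n : ℕ} (hn : n ≠ 0) (h : ζ ^ n = 1) : ‖ζ‖ = 1 := by
  have := congrArg norm h
  rw [norm_pow, norm_one] at this
  exact (pow_eq_one_iff_of_nonneg (norm_nonneg _) hn).1 this

lemma norm_p : ‖(p : Ω)‖ = (p : ℝ)⁻¹ := by
  rw [← map_natCast (algebraMap ℚ_[p] Ω), PadicAlgCl.norm_extends, Padic.norm_p]

lemma norm_p_lt : ‖(p : Ω)‖ < 1 := by
  rw [norm_p]
  exact inv_lt_one_of_one_lt₀ (by exact_mod_cast hp.1.one_lt)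

lemma norm_nat_le (n : ℕ) : ‖(n : Ω)‖ ≤ 1 := IsUltrametricDist.norm_natCast_le_one _ n

lemma norm_int_le (n : ℤ) : ‖(n : Ω)‖ ≤ 1 := IsUltrametricDist.norm_intCast_le_one _ n

lemma norm_int_lt_iff (n : ℤ) : ‖(n : Ω)‖ < 1 ↔ (p : ℤ) ∣ n := by
  rw [← map_intCast (algebraMap ℚ_[p] Ω), PadicAlgCl.norm_extends, Padic.norm_intCast_lt_one_iff]

lemma norm_int_le_p (n : ℤ) (h : ‖(n : Ω)‖ < 1) : ‖(n : Ω)‖ ≤ ‖(p : Ω)‖ := by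
  obtain ⟨m, rfl⟩ := (norm_int_lt_iff n).1 h
  push_cast
  rw [norm_mul]
  exact mul_le_of_le_one_right (norm_nonneg _) (norm_int_le m)

lemma norm_pow_sub_pow (x y : Ω) (hx : ‖x‖ ≤ 1) (hy : ‖y‖ ≤ 1) (n : ℕ) :
    ‖x ^ n - y ^ n‖ ≤ ‖x - y‖ := by
  rw [← Commute.geom_sum₂_mul (Commute.all x y), norm_mul]
  refine mul_le_of_le_one_left (norm_nonneg _) ?_
  refine IsUltrametricDist.norm_sum_le_of_forall_le_of_nonneg zero_le_one fun i _ => ?_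
  rw [norm_mul, norm_pow, norm_pow]
  exact mul_le_one₀ (pow_le_one₀ (norm_nonneg _) hx) (by positivity)
    (pow_le_one₀ (norm_nonneg _) hy)

/-! ### The uniformizer -/

lemma norm_zeta_pow_sub_le {ζ : Ω} (hζ : ‖ζ‖ = 1) (i : ℕ) : ‖ζ ^ i - 1‖ ≤ ‖ζ - 1‖ := by
  simpa using norm_pow_sub_pow ζ 1 hζ.le (by simp) i

lemma norm_prim_eq {ζ μ : Ω} {n : ℕ} (hn : 0 < n) (h : IsPrimitiveRoot ζ n)
    (h' : IsPrimitiveRoot μ n) : ‖1 - μ‖ = ‖ζ - 1‖ := by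
  rw [norm_sub_rev]
  have : NeZero n := ⟨hn.ne'⟩
  obtain ⟨i, -, hi⟩ := h.eq_pow_of_pow_eq_one h'.pow_eq_one
  obtain ⟨j, -, hj⟩ := h'.eq_pow_of_pow_eq_one h.pow_eq_one
  apply le_antisymm
  · rw [← hi]; exact norm_zeta_pow_sub_le (norm_root hn.ne' h.pow_eq_one) _
  · rw [← hj]; exact norm_zeta_pow_sub_le (norm_root hn.ne' h'.pow_eq_one) _

lemma norm_pi_pow {ζ : Ω} (h : IsPrimitiveRoot ζ p) : ‖ζ - 1‖ ^ (p - 1) = (p : ℝ)⁻¹ := by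
  have h1 := eval_one_cyclotomic_prime (R := Ω) (p := p)
  rw [cyclotomic_eq_prod_X_sub_primitiveRoots h, eval_prod] at h1
  have h2 := congrArg norm h1
  rw [norm_prod, norm_p] at h2
  rw [← h2, Finset.prod_congr rfl (g := fun _ => ‖ζ - 1‖), Finset.prod_const, h.card_primitiveRoots,
    Nat.totient_prime hp.1]
  intro μ hμ
  rw [mem_primitiveRoots hp.1.pos] at hμ
  simp [norm_prim_eq hp.1.pos h hμ]

lemma pi_ne {ζ : Ω} (h : IsPrimitiveRoot ζ p) : ζ - 1 ≠ 0 :=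
  sub_ne_zero.2 (h.ne_one hp.1.one_lt)

lemma norm_pi_pos {ζ : Ω} (h : IsPrimitiveRoot ζ p) : 0 < ‖ζ - 1‖ := norm_pos_iff.2 (pi_ne h)

lemma norm_pi_lt {ζ : Ω} (h : IsPrimitiveRoot ζ p) : ‖ζ - 1‖ < 1 := by
  by_contra hc
  have h1 := norm_pi_pow h
  have := one_le_pow₀ (not_lt.1 hc) (n := p - 1)
  rw [h1] at this
  have h3 : (p : ℝ)⁻¹ < 1 := inv_lt_one_of_one_lt₀ (by exact_mod_cast hp.1.one_lt)
  linarith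

lemma norm_p_le_pi {ζ : Ω} (h : IsPrimitiveRoot ζ p) : ‖(p : Ω)‖ ≤ ‖ζ - 1‖ := by
  rw [norm_p, ← norm_pi_pow h]
  have := hp.1.two_le
  exact pow_le_of_le_one (norm_nonneg _) (norm_pi_lt h).le (by omega)

lemma pow_sub_one_prod {ζ : Ω} {n : ℕ} (hn : 0 < n) (h : IsPrimitiveRoot ζ n) (x : Ω) :
    x ^ n - 1 = ∏ i ∈ Finset.range n, (x - ζ ^ i) := by
  have h1 := X_pow_sub_C_eq_prod h hn (one_pow n)
  have h2 := congrArg (eval x) h1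
  rw [eval_prod] at h2
  simpa using h2

/-- an element close to a `p`-th root of unity -/
lemma exists_close {ζ : Ω} {n : ℕ} (hn : 0 < n) (h : IsPrimitiveRoot ζ n) (x : Ω)
    (hx : ‖x ^ n - 1‖ < 1) : ∃ i, ‖x - ζ ^ i‖ < 1 := by
  by_contra! hc
  rw [pow_sub_one_prod hn h, norm_prod] at hx
  have : (1 : ℝ) ≤ ∏ i ∈ Finset.range n, ‖x - ζ ^ i‖ :=
    Finset.prod_induction _ (fun t : ℝ => 1 ≤ t) (fun a b ha hb => one_le_mul_of_one_le_of_one_le ha hb)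
      le_rfl (fun i _ => hc i)
  linarith

lemma norm_zeta_pow_sub_one_of_not_dvd {ζ : Ω} (h : IsPrimitiveRoot ζ p) {i : ℕ} (hi : ¬ p ∣ i) :
    ‖ζ ^ i - 1‖ = ‖ζ - 1‖ := by
  rw [norm_sub_rev]
  exact norm_prim_eq hp.1.pos h
    (h.pow_of_coprime i ((Nat.coprime_comm).1 ((Nat.Prime.coprime_iff_not_dvd hp.1).2 hi)))

/-- `p`-th powers close to one are very close to one. -/
lemma norm_pow_p_sub_one {ζ : Ω} (h : IsPrimitiveRoot ζ p) {x : Ω} (hx : ‖x - 1‖ ≤ ‖ζ - 1‖) :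
    ‖x ^ p - 1‖ ≤ ‖ζ - 1‖ ^ p := by
  rw [pow_sub_one_prod hp.1.pos h, norm_prod]
  calc _ ≤ ∏ i ∈ Finset.range p, ‖ζ - 1‖ := by
        refine Finset.prod_le_prod (fun _ _ => norm_nonneg _) fun i _ => ?_
        have := norm_sub_le' (x - 1) (ζ ^ i - 1) hx
          (norm_zeta_pow_sub_le (norm_root hp.1.ne_zero h.pow_eq_one) i)
        simpa using this
    _ = _ := by simp

lemma norm_sub_one_lt {ζ : Ω} (h : IsPrimitiveRoot ζ p) {x : Ω} (hx : ‖x ^ p - 1‖ < 1) :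
    ‖x - 1‖ < 1 := by
  obtain ⟨i, hi⟩ := exists_close hp.1.pos h x hx
  have := norm_add_lt' _ _ hi
    ((norm_zeta_pow_sub_le (norm_root hp.1.ne_zero h.pow_eq_one) i).trans_lt (norm_pi_lt h))
  simpa using this

lemma norm_sub_one_le_of_pow {ζ : Ω} (h : IsPrimitiveRoot ζ p) {x : Ω}
    (hx : ‖x ^ p - 1‖ ≤ ‖ζ - 1‖ ^ p) : ‖x - 1‖ ≤ ‖ζ - 1‖ := by
  by_contra! hc
  rw [pow_sub_one_prod hp.1.pos h, norm_prod] at hx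
  have : ∀ i ∈ Finset.range p, ‖x - ζ ^ i‖ = ‖x - 1‖ := by
    intro i _
    have h1 : ‖ζ ^ i - 1‖ < ‖x - 1‖ :=
      (norm_zeta_pow_sub_le (norm_root hp.1.ne_zero h.pow_eq_one) i).trans_lt hc
    have h2 := IsUltrametricDist.norm_add_eq_max_of_norm_ne_norm
      (x := x - 1) (y := -(ζ ^ i - 1)) (by rw [norm_neg]; exact h1.ne')
    rw [norm_neg, max_eq_left h1.le] at h2
    rw [← h2]; congr 1; ring
  rw [Finset.prod_congr rfl this, Finset.prod_const, Finset.card_range] at hx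
  exact absurd hx (not_le.2 (pow_lt_pow_left₀ hc (norm_nonneg _) hp.1.ne_zero))

end LKW

namespace LKW

open Polynomial

variable {p : ℕ} [hp : Fact p.Prime]

local notation "Ω" => PadicAlgCl p

/-! ### The structure of `K = ℚ_p(ζ)` -/

lemma norm_term {ζ : Ω} (h : IsPrimitiveRoot ζ p) {c : ℚ_[p]} (hc : c ≠ 0) (i : ℕ) :
    ‖algebraMap ℚ_[p] Ω c * (ζ - 1) ^ i‖ = ‖ζ - 1‖ ^ (((p - 1 : ℕ) : ℤ) * c.valuation + i) := by
  rw [norm_mul, PadicAlgCl.norm_extends, Padic.norm_eq_zpow_neg_valuation hc, norm_pow, zpow_neg,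
    ← inv_zpow, ← norm_pi_pow h, zpow_add₀ (norm_pi_pos h).ne', zpow_mul, zpow_natCast,
    zpow_natCast]

lemma norm_sum_terms {ζ : Ω} (h : IsPrimitiveRoot ζ p) (c : ℕ → ℚ_[p]) :
    (∀ i < p - 1, ‖algebraMap ℚ_[p] Ω (c i) * (ζ - 1) ^ i‖ ≤
      ‖∑ i ∈ Finset.range (p - 1), algebraMap ℚ_[p] Ω (c i) * (ζ - 1) ^ i‖) ∧
    (∑ i ∈ Finset.range (p - 1), algebraMap ℚ_[p] Ω (c i) * (ζ - 1) ^ i ≠ 0 →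
      ∃ i, i < p - 1 ∧ c i ≠ 0 ∧
      ‖∑ i ∈ Finset.range (p - 1), algebraMap ℚ_[p] Ω (c i) * (ζ - 1) ^ i‖ =
      ‖algebraMap ℚ_[p] Ω (c i) * (ζ - 1) ^ i‖) := by
  classical
  set t : ℕ → Ω := fun i => algebraMap ℚ_[p] Ω (c i) * (ζ - 1) ^ i with ht
  set s := (Finset.range (p - 1)).filter (fun i => c i ≠ 0) with hs
  have hS : ∑ i ∈ Finset.range (p - 1), t i = ∑ i ∈ s, t i := by
    rw [hs, Finset.sum_filter_of_ne]
    intro i _ hi hc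
    apply hi
    simp [ht, hc]
  change (∀ i < p - 1, ‖t i‖ ≤ ‖∑ i ∈ Finset.range (p - 1), t i‖) ∧
    (∑ i ∈ Finset.range (p - 1), t i ≠ 0 → ∃ i, i < p - 1 ∧ c i ≠ 0 ∧
      ‖∑ i ∈ Finset.range (p - 1), t i‖ = ‖t i‖)
  rw [hS]
  rcases s.eq_empty_or_nonempty with he | hne
  · refine ⟨fun i hi => ?_, fun h0 => ?_⟩
    · have : c i = 0 := by
        by_contra hc
        have : i ∈ s := by simp [hs, hi, hc]
        simp [he] at this
      simp [ht, this]
    · simp [he] at h0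
  · have key := IsUltrametricDist.norm_sum_eq_sup'_of_pairwise_ne (s := s) (f := t) hne (by
      intro i hi j hj hij heq
      simp only [hs, Finset.coe_filter, Finset.mem_range, Set.mem_ofPred_eq] at hi hj
      simp only [ht] at heq
      rw [norm_term h hi.2, norm_term h hj.2] at heq
      have h1 := zpow_right_injective₀ (norm_pi_pos h) (norm_pi_lt h).ne heq
      have h2 : ((p - 1 : ℕ) : ℤ) ∣ (i : ℤ) - j := by
        refine ⟨(c j).valuation - (c i).valuation, ?_⟩
        linear_combination h1
      have h3 := Int.eq_zero_of_abs_lt_dvd h2 (by rw [abs_lt]; omega)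
      omega)
    rw [key]
    refine ⟨fun i hi => ?_, fun _ => ?_⟩
    · by_cases hc : c i = 0
      · obtain ⟨j, hj⟩ := hne
        refine le_trans ?_ (Finset.le_sup' (fun i => ‖t i‖) hj)
        simp only [ht, hc, map_zero, zero_mul, norm_zero]
        exact norm_nonneg _
      · exact Finset.le_sup' (fun i => ‖t i‖) (by simp [hs, hi, hc])
    · obtain ⟨j, hj, hj'⟩ := Finset.exists_mem_eq_sup' hne (fun i => ‖t i‖)
      simp only [hs, Finset.mem_filter, Finset.mem_range] at hj
      exact ⟨j, hj.1, hj.2, hj'⟩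

lemma aeval_cyc_comp {ζ : Ω} (h : IsPrimitiveRoot ζ p) :
    aeval (ζ - 1) ((cyclotomic p ℚ_[p]).comp (X + 1)) = 0 := by
  rw [aeval_comp]
  simp only [map_add, aeval_X, map_one, sub_add_cancel]
  rw [aeval_def, eval₂_eq_eval_map, map_cyclotomic]
  exact h.isRoot_cyclotomic hp.1.pos

lemma exists_sum_of_mem {ζ : Ω} (h : IsPrimitiveRoot ζ p) {x : Ω}
    (hx : x ∈ IntermediateField.adjoin ℚ_[p] {ζ}) :
    ∃ c : ℕ → ℚ_[p], x = ∑ i ∈ Finset.range (p - 1), algebraMap ℚ_[p] Ω (c i) * (ζ - 1) ^ i := by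
  have hx' : x ∈ IntermediateField.adjoin ℚ_[p] {ζ - 1} := by
    refine (IntermediateField.adjoin_le_iff (T := IntermediateField.adjoin ℚ_[p] {ζ - 1})).2 ?_ hx
    intro y hy
    rw [Set.mem_singleton_iff] at hy
    subst hy
    have := add_mem (IntermediateField.mem_adjoin_simple_self ℚ_[p] (y - 1))
      (one_mem (IntermediateField.adjoin ℚ_[p] {y - 1}))
    simpa using this
  rw [← IntermediateField.mem_toSubalgebra, IntermediateField.adjoin_simple_toSubalgebra_of_isAlgebraic
    (Algebra.IsAlgebraic.isAlgebraic _), Algebra.adjoin_singleton_eq_range_aeval] at hx'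
  obtain ⟨f, rfl⟩ := hx'
  set g := (cyclotomic p ℚ_[p]).comp (X + 1) with hg
  have hdeg : g.natDegree = p - 1 := by
    rw [hg, natDegree_comp, natDegree_cyclotomic, Nat.totient_prime hp.1]
    have : (X + 1 : ℚ_[p][X]).natDegree = 1 := by simpa using natDegree_X_add_C (1 : ℚ_[p])
    rw [this, mul_one]
  have hm : g.Monic := by
    have := (cyclotomic.monic p ℚ_[p]).comp_X_add_C 1
    simpa [hg] using this
  have h2 := hp.1.two_le
  have hlt : (f %ₘ g).natDegree < p - 1 := by
    rw [← hdeg]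
    apply natDegree_modByMonic_lt _ hm
    intro h1
    rw [h1, natDegree_one] at hdeg
    omega
  refine ⟨(f %ₘ g).coeff, ?_⟩
  have h1 : aeval (ζ - 1) f = aeval (ζ - 1) (f %ₘ g) := by
    conv_lhs => rw [← modByMonic_add_div f g]
    rw [map_add, map_mul, hg, aeval_cyc_comp h, zero_mul, add_zero]
  change aeval (ζ - 1) f = _
  rw [h1, aeval_eq_sum_range' hlt]
  simp [Algebra.smul_def]

/-- value group of `K` -/
lemma exists_norm_eq {ζ : Ω} (h : IsPrimitiveRoot ζ p) {x : Ω}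
    (hx : x ∈ IntermediateField.adjoin ℚ_[p] {ζ}) (hx0 : x ≠ 0) :
    ∃ m : ℤ, ‖x‖ = ‖ζ - 1‖ ^ m := by
  obtain ⟨c, rfl⟩ := exists_sum_of_mem h hx
  obtain ⟨i, -, hc, hi⟩ := (norm_sum_terms h c).2 hx0
  exact ⟨_, hi.trans (norm_term h hc i)⟩

lemma norm_le_pi {ζ : Ω} (h : IsPrimitiveRoot ζ p) {x : Ω}
    (hx : x ∈ IntermediateField.adjoin ℚ_[p] {ζ}) (hx1 : ‖x‖ < 1) : ‖x‖ ≤ ‖ζ - 1‖ := by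
  by_cases hx0 : x = 0
  · simp [hx0]
  obtain ⟨m, hm⟩ := exists_norm_eq h hx hx0
  rw [hm] at hx1 ⊢
  have : 0 < m := by
    by_contra hc
    have := one_le_zpow_of_nonpos₀ (norm_pi_pos h) (norm_pi_lt h).le (not_lt.1 hc)
    linarith
  conv_rhs => rw [← zpow_one ‖ζ - 1‖]
  exact zpow_le_zpow_right_of_le_one₀ (norm_pi_pos h) (norm_pi_lt h).le (by omega)

/-- residue field of `K` -/
lemma exists_int_close {ζ : Ω} (h : IsPrimitiveRoot ζ p) {x : Ω}
    (hx : x ∈ IntermediateField.adjoin ℚ_[p] {ζ}) (hx1 : ‖x‖ ≤ 1) :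
    ∃ n : ℕ, ‖x - n‖ ≤ ‖ζ - 1‖ := by
  suffices ∃ n : ℕ, ‖x - n‖ < 1 by
    obtain ⟨n, hn⟩ := this
    exact ⟨n, norm_le_pi h (sub_mem hx (natCast_mem _ n)) hn⟩
  obtain ⟨c, rfl⟩ := exists_sum_of_mem h hx
  have h1 := (norm_sum_terms h c).1
  have h2 := hp.1.two_le
  have hc0 : ‖c 0‖ ≤ 1 := by
    have := (h1 0 (by omega)).trans hx1
    simpa [PadicAlgCl.norm_extends] using this
  have hrest : ∀ i ∈ Finset.Ico 1 (p - 1), ‖algebraMap ℚ_[p] Ω (c i) * (ζ - 1) ^ i‖ ≤ ‖ζ - 1‖ := by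
    intro i hi
    rw [Finset.mem_Ico] at hi
    refine norm_le_pi h ?_ ?_
    · exact mul_mem (IntermediateField.algebraMap_mem _ _)
        (pow_mem (sub_mem (IntermediateField.mem_adjoin_simple_self _ _) (one_mem _)) _)
    · refine lt_of_le_of_ne ((h1 i hi.2).trans hx1) fun heq => ?_
      by_cases hci : c i = 0
      · simp [hci] at heq
      rw [norm_term h hci, zpow_eq_one_iff_right₀ (norm_nonneg _) (norm_pi_lt h).ne] at heq
      have h3 : ((p - 1 : ℕ) : ℤ) ∣ (i : ℤ) := ⟨-(c i).valuation, by linear_combination heq⟩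
      have h4 := Int.eq_zero_of_abs_lt_dvd h3 (by rw [abs_lt]; omega)
      omega
  obtain ⟨z, hz⟩ : ∃ z : ℤ_[p], (z : ℚ_[p]) = c 0 := ⟨⟨c 0, hc0⟩, rfl⟩
  obtain ⟨n, hn⟩ := PadicInt.exists_mem_range (p := p) z
  obtain ⟨hn1, hn2⟩ := hn
  refine ⟨n, ?_⟩
  rw [Finset.range_eq_Ico, Finset.sum_eq_sum_Ico_succ_bot (by omega)]
  have e1 : ‖algebraMap ℚ_[p] Ω (c 0) - n‖ < 1 := by
    rw [← map_natCast (algebraMap ℚ_[p] Ω), ← map_sub, PadicAlgCl.norm_extends]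
    rw [IsLocalRing.mem_maximalIdeal, PadicInt.mem_nonunits] at hn2
    rw [PadicInt.norm_def, PadicInt.coe_sub, PadicInt.coe_natCast, hz] at hn2
    exact hn2
  have e2 : ‖∑ i ∈ Finset.Ico 1 (p - 1), algebraMap ℚ_[p] Ω (c i) * (ζ - 1) ^ i‖ < 1 :=
    (IsUltrametricDist.norm_sum_le_of_forall_le_of_nonneg (norm_nonneg _) hrest).trans_lt
      (norm_pi_lt h)
  have := norm_add_lt' _ _ e1 e2
  convert this using 2
  simp
  ring

lemma minpoly_zeta {ζ : Ω} (h : IsPrimitiveRoot ζ p) :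
    minpoly ℚ_[p] ζ = cyclotomic p ℚ_[p] := by
  have hintegral : IsIntegral ℚ_[p] ζ := Algebra.IsIntegral.isIntegral ζ
  have hdvd : minpoly ℚ_[p] ζ ∣ cyclotomic p ℚ_[p] := by
    apply minpoly.dvd
    rw [aeval_def, eval₂_eq_eval_map, map_cyclotomic]
    exact h.isRoot_cyclotomic hp.1.pos
  refine (eq_of_monic_of_dvd_of_natDegree_le (minpoly.monic hintegral) (cyclotomic.monic p _) hdvd ?_).symm
  rw [natDegree_cyclotomic, Nat.totient_prime hp.1]
  by_contra! hlt
  set f := (minpoly ℚ_[p] ζ).comp (X + C 1) with hf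
  have hfd : f.natDegree < p - 1 := by
    rw [hf, natDegree_comp, natDegree_X_add_C, mul_one]; exact hlt
  have hf0 : aeval (ζ - 1) f = 0 := by
    rw [hf, aeval_comp]
    simp
  rw [aeval_eq_sum_range' hfd] at hf0
  have h1 := (norm_sum_terms h f.coeff).1
  simp only [← Algebra.smul_def, hf0, norm_zero] at h1
  have hm : f.Monic := (minpoly.monic hintegral).comp_X_add_C 1
  have h2 := h1 f.natDegree hfd
  rw [hm.coeff_natDegree, one_smul, norm_pow] at h2
  have := pow_pos (norm_pi_pos h) f.natDegree
  linarith

lemma exists_aut {ζ : Ω} (h : IsPrimitiveRoot ζ p) {g : ℕ} (hg : g.Coprime p) :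
    ∃ σ : Ω ≃ₐ[ℚ_[p]] Ω, σ ζ = ζ ^ g := by
  have : IsConjRoot ℚ_[p] (ζ ^ g) ζ := by
    rw [IsConjRoot, minpoly_zeta h, minpoly_zeta (h.pow_of_coprime g hg)]
  obtain ⟨σ, hσ⟩ := isConjRoot_iff_exists_algEquiv.1 this
  exact ⟨σ, hσ⟩

end LKW

namespace LKW

open Polynomial

/-! ### Residue field arguments -/

lemma pow_card_sub_eq_prod (A k : Type*) [Field A] [Fintype A] [Field k] [Algebra A k] (x : k) :
    x ^ Fintype.card A - x = ∏ a : A, (x - algebraMap A k a) := by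
  have h1 : (X ^ Fintype.card A - X : A[X]) = ∏ a : A, (X - C a) := by
    have := prod_multiset_X_sub_C_of_monic_of_roots_card_eq (p := (X ^ Fintype.card A - X : A[X]))
      (monic_X_pow_sub (by
        rw [degree_X]; exact_mod_cast Fintype.one_lt_card)) (by
        rw [FiniteField.roots_X_pow_card_sub_X, FiniteField.X_pow_card_sub_X_natDegree_eq _
          Fintype.one_lt_card]; rfl)
    rw [FiniteField.roots_X_pow_card_sub_X] at this
    exact this.symm
  have h2 := congrArg (aeval x) h1
  simpa [map_prod] using h2

lemma prod_range_sub (p : ℕ) [hp : Fact p.Prime] (k : Type*) [Field k] [CharP k p] (x : k) :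
    ∏ i ∈ Finset.range p, (x - (i : k)) = x ^ p - x := by
  let inst := ZMod.algebra k p
  have h := pow_card_sub_eq_prod (ZMod p) k x
  rw [ZMod.card] at h
  rw [h]
  refine Finset.prod_bij (fun i _ => (i : ZMod p)) (fun _ _ => Finset.mem_univ _) ?_ ?_ ?_
  · intro i hi j hj hij
    rw [Finset.mem_range] at hi hj
    rw [ZMod.natCast_eq_natCast_iff'] at hij
    rwa [Nat.mod_eq_of_lt hi, Nat.mod_eq_of_lt hj] at hij
  · intro b _
    exact ⟨b.val, Finset.mem_range.2 (ZMod.val_lt b), by simp⟩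
  · intro i _
    simp

lemma as_iterate (p : ℕ) [hp : Fact p.Prime] (k : Type*) [Field k] [CharP k p] {y : k} {n : ℕ}
    (h : y ^ p = y + n) (j : ℕ) : y ^ (p ^ j) = y + j * n := by
  induction j with
  | zero => simp
  | succ j ih =>
    rw [pow_succ, pow_mul, ih, add_pow_char, h, mul_pow]
    have h1 : ∀ m : ℕ, (m : k) ^ p = m := fun m => by
      have := map_natCast (frobenius k p) m
      rwa [frobenius_def] at this
    rw [h1, h1]
    push_cast
    ring

lemma exists_poly (p : ℕ) [hp : Fact p.Prime] (k : Type*) [Field k] [CharP k p] {x y : k}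
    (hy : y ^ p = y + 1) (hx : x ^ (p ^ p) = x) : ∃ f : ℤ[X], aeval y f = x := by
  let inst := ZMod.algebra k p
  have hmon : (X ^ p - X - C 1 : (ZMod p)[X]).Monic := by
    rw [sub_sub]
    apply monic_X_pow_sub
    compute_degree
    exact_mod_cast hp.1.one_lt
  have hdeg : (X ^ p - X - C 1 : (ZMod p)[X]).natDegree = p := by
    rw [sub_sub]
    apply natDegree_sub_eq_left_of_natDegree_lt _ |>.trans (natDegree_X_pow p)
    rw [natDegree_X_pow, natDegree_X_add_C]
    exact hp.1.one_lt
  have hroot : aeval y (X ^ p - X - C 1 : (ZMod p)[X]) = 0 := by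
    simp [hy]
  have hintegral : IsIntegral (ZMod p) y := ⟨_, hmon, hroot⟩
  set A := IntermediateField.adjoin (ZMod p) {y} with hA
  have : FiniteDimensional (ZMod p) A := IntermediateField.adjoin.finiteDimensional hintegral
  have : Finite A := Module.finite_of_finite (ZMod p)
  let inst := Fintype.ofFinite A
  have hle : Module.finrank (ZMod p) A ≤ p := by
    rw [IntermediateField.adjoin.finrank hintegral]
    conv_rhs => rw [← hdeg]
    exact natDegree_le_of_dvd (minpoly.dvd _ _ hroot) hmon.ne_zero
  have hpos : 0 < Module.finrank (ZMod p) A := Module.finrank_pos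
  have hcard : Fintype.card A = p ^ Module.finrank (ZMod p) A := by
    rw [Module.card_eq_pow_finrank (K := ZMod p), ZMod.card]
  set d := Module.finrank (ZMod p) A with hd
  have hyA : y ∈ A := IntermediateField.mem_adjoin_simple_self _ _
  have hdp : d = p := by
    have h1 := FiniteField.pow_card (⟨y, hyA⟩ : A)
    rw [hcard] at h1
    have h2 := congrArg (fun a : A => (a : k)) h1
    simp only [SubmonoidClass.mk_pow] at h2
    rw [as_iterate p k (n := 1) (by simpa using hy)] at h2
    have h3 : ((d : ℕ) : k) = 0 := by simpa using h2
    rw [CharP.cast_eq_zero_iff k p] at h3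
    exact le_antisymm hle (Nat.le_of_dvd hpos h3)
  have hprod := pow_card_sub_eq_prod A k x
  rw [hcard, hdp, hx, sub_self, eq_comm, Finset.prod_eq_zero_iff] at hprod
  obtain ⟨a, -, ha⟩ := hprod
  have hxA : x ∈ A := by
    rw [sub_eq_zero.1 ha]; exact a.2
  rw [hA, ← IntermediateField.mem_toSubalgebra,
    IntermediateField.adjoin_simple_toSubalgebra_of_isAlgebraic hintegral.isAlgebraic,
    Algebra.adjoin_singleton_eq_range_aeval] at hxA
  obtain ⟨f, hf⟩ := hxA
  obtain ⟨f', rfl⟩ := Polynomial.map_surjective (Int.castRingHom (ZMod p))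
    (ZMod.intCast_surjective) f
  refine ⟨f', ?_⟩
  rw [← hf]
  change _ = aeval y (map (Int.castRingHom (ZMod p)) f')
  rw [← algebraMap_int_eq, aeval_map_algebraMap]

variable {p : ℕ} [hp : Fact p.Prime]

local notation "Ω" => PadicAlgCl p

lemma exists_residue (p : ℕ) [hp : Fact p.Prime] : ∃ (O : Subring (PadicAlgCl p)) (k : Type)
    (_ : Field k) (_ : CharP k p) (r : O →+* k),
    (∀ x, x ∈ O ↔ ‖x‖ ≤ 1) ∧ (∀ x : O, r x = 0 ↔ ‖(x : PadicAlgCl p)‖ < 1) := by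
  let V := (PadicAlgCl.valued p).v.valuationSubring
  have hmem : ∀ x, x ∈ V.toSubring ↔ ‖x‖ ≤ 1 := by
    intro x
    change Valued.v x ≤ 1 ↔ _
    rw [PadicAlgCl.valuation_def]
    exact Iff.rfl
  have hz : ∀ x : V.toSubring, IsLocalRing.residue V x = 0 ↔ ‖(x : PadicAlgCl p)‖ < 1 := by
    intro x
    rw [IsLocalRing.residue_eq_zero_iff, Valuation.mem_maximalIdeal_iff]
    exact Iff.rfl
  refine ⟨V.toSubring, IsLocalRing.ResidueField V, inferInstance, ?_, IsLocalRing.residue V, hmem, hz⟩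
  have h0 : ((p : ℕ) : IsLocalRing.ResidueField V) = 0 := by
    have := (hz (p : V.toSubring)).2 (by simpa using norm_p_lt (p := p))
    rwa [map_natCast] at this
  have := CharP.ringChar_of_prime_eq_zero hp.1 h0
  exact ringChar.of_eq this

end LKW

namespace LKW

open Polynomial

variable {p : ℕ} [hp : Fact p.Prime]

local notation "Ω" => PadicAlgCl p

/-- Artin Schreier congruence -/
lemma as_congr {ζ : Ω} (h : IsPrimitiveRoot ζ p) {y c : Ω} (hy : ‖y‖ ≤ 1)
    (hc : (1 + (ζ - 1) * y) ^ p - 1 = (ζ - 1) ^ p * c) : ‖y ^ p - y - c‖ < 1 := by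
  obtain ⟨O, k, _, _, r, hO, hr⟩ := exists_residue p
  have hζO : ζ ∈ O := (hO ζ).2 (norm_root hp.1.ne_zero h.pow_eq_one).le
  let z : O := ⟨ζ, hζO⟩
  let yo : O := ⟨y, (hO y).2 hy⟩
  have hrz : r z = 1 := by
    have := (hr (z - 1)).2 (norm_pi_lt h)
    rwa [map_sub, map_one, sub_eq_zero] at this
  have hc' : c = ((∏ i ∈ Finset.range p, (yo - ∑ j ∈ Finset.range i, z ^ j) : O) : Ω) := by
    rw [pow_sub_one_prod hp.1.pos h] at hc
    have h1 : ∏ i ∈ Finset.range p, (1 + (ζ - 1) * y - ζ ^ i) =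
        (ζ - 1) ^ p * ((∏ i ∈ Finset.range p, (yo - ∑ j ∈ Finset.range i, z ^ j) : O) : Ω) := by
      push_cast
      have : (ζ - 1) ^ p = ∏ i ∈ Finset.range p, (ζ - 1) := by simp
      rw [this, ← Finset.prod_mul_distrib]
      refine Finset.prod_congr rfl fun i _ => ?_
      have := mul_geom_sum ζ i
      simp only [yo, z]
      linear_combination this
    rw [h1] at hc
    exact (mul_left_cancel₀ (pow_ne_zero _ (pi_ne h)) hc).symm
  have h2 := (hr (yo ^ p - yo - ∏ i ∈ Finset.range p, (yo - ∑ j ∈ Finset.range i, z ^ j))).1 (by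
    simp only [map_sub, map_pow, map_prod, map_sum, hrz, one_pow, Finset.sum_const,
      Finset.card_range, nsmul_eq_mul, mul_one]
    rw [prod_range_sub, sub_self])
  rw [hc']
  exact h2

lemma as_pow {y : Ω} (hy : ‖y‖ ≤ 1) {n : ℕ} (h : ‖y ^ p - y - n‖ < 1) :
    ‖y ^ (p ^ p) - y‖ < 1 := by
  obtain ⟨O, k, _, _, r, hO, hr⟩ := exists_residue p
  let yo : O := ⟨y, (hO y).2 hy⟩
  have h1 := (hr (yo ^ p - yo - n)).2 h
  rw [map_sub, map_sub, map_pow, map_natCast, sub_sub, sub_eq_zero] at h1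
  have h2 := as_iterate p k h1 p
  refine (hr (yo ^ (p ^ p) - yo)).1 ?_
  rw [map_sub, map_pow, h2]
  simp

lemma exists_close_root {ζq : Ω} (hq : IsPrimitiveRoot ζq (p ^ p - 1)) {y : Ω}
    (h : ‖y ^ (p ^ p) - y‖ < 1) : ∃ z : Ω, (z = 0 ∨ ∃ i : ℕ, z = ζq ^ i) ∧ ‖y - z‖ < 1 := by
  have h1 : 1 < p ^ p := Nat.one_lt_pow hp.1.ne_zero hp.1.one_lt
  have h2 : y ^ (p ^ p) - y = y * (y ^ (p ^ p - 1) - 1) := by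
    rw [mul_sub, ← pow_succ', Nat.sub_add_cancel h1.le, mul_one]
  by_cases h3 : ‖y‖ < 1
  · exact ⟨0, Or.inl rfl, by simpa using h3⟩
  · rw [h2, norm_mul] at h
    have h4 : ‖y ^ (p ^ p - 1) - 1‖ < 1 := by
      by_contra hc
      have := one_le_mul_of_one_le_of_one_le (not_lt.1 h3) (not_lt.1 hc)
      linarith
    obtain ⟨i, hi⟩ := exists_close (by omega) hq y h4
    exact ⟨_, Or.inr ⟨i, rfl⟩, hi⟩

lemma root_eq_one {μ : Ω} {N : ℕ} (hN : ‖(N : Ω)‖ = 1) (h : μ ^ N = 1) (h1 : ‖μ - 1‖ < 1) :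
    μ = 1 := by
  by_contra hne
  have hN0 : N ≠ 0 := by rintro rfl; simp at hN
  have h2 := mul_geom_sum μ N
  rw [h, sub_self, mul_eq_zero, or_iff_right (sub_ne_zero.2 hne)] at h2
  have h3 : ‖∑ i ∈ Finset.range N, (μ ^ i - 1)‖ ≤ ‖μ - 1‖ :=
    IsUltrametricDist.norm_sum_le_of_forall_le_of_nonneg (norm_nonneg _) fun i _ =>
      norm_zeta_pow_sub_le (norm_root hN0 h) i
  rw [Finset.sum_sub_distrib, h2] at h3
  simp at h3
  linarith

lemma norm_q : ‖((p ^ p - 1 : ℕ) : Ω)‖ = 1 := by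
  have h1 : 1 ≤ p ^ p := Nat.one_le_pow _ _ hp.1.pos
  refine le_antisymm (norm_nat_le _) (not_lt.1 fun h => ?_)
  have h2 : ((p ^ p - 1 : ℕ) : Ω) = (((p ^ p - 1 : ℕ) : ℤ) : Ω) := by push_cast; rfl
  rw [h2, norm_int_lt_iff] at h
  have h3 : p ∣ p ^ p - 1 := by exact_mod_cast h
  have h4 : p ∣ p ^ p := dvd_pow_self p hp.1.ne_zero
  have h5 := (Nat.dvd_sub_iff_right h1 h4).1 h3
  exact hp.1.one_lt.ne' (Nat.dvd_one.1 h5)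

lemma eq_zeta_pow_mul {ζ : Ω} {n : ℕ} (hn : 0 < n) (h : IsPrimitiveRoot ζ n) {a b : Ω} (hb : b ≠ 0)
    (hab : a ^ n = b ^ n) : ∃ i, a = ζ ^ i * b := by
  have : NeZero n := ⟨hn.ne'⟩
  obtain ⟨i, -, hi⟩ := h.eq_pow_of_pow_eq_one (ξ := a / b) (by
    rw [div_pow, hab, div_self (pow_ne_zero _ hb)])
  exact ⟨i, by rw [hi, div_mul_cancel₀ _ hb]⟩

/-- A version of the lemma of Krasner -/
lemma krasner {ζ : Ω} (h : IsPrimitiveRoot ζ p) {y z : Ω} (hα : ‖1 + (ζ - 1) * y‖ = 1)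
    (hz : ‖y - z‖ < 1) (σ : Ω ≃ₐ[ℚ_[p]] Ω) (hσζ : σ ζ = ζ) (hσz : σ z = z)
    (hσ : σ ((1 + (ζ - 1) * y) ^ p) = (1 + (ζ - 1) * y) ^ p) : σ y = y := by
  set α := 1 + (ζ - 1) * y with hαdef
  have hα0 : α ≠ 0 := by rw [← norm_pos_iff, hα]; exact one_pos
  rw [map_pow] at hσ
  obtain ⟨i, hi⟩ := eq_zeta_pow_mul hp.1.pos h hα0 hσ
  have hy : (ζ - 1) * (σ y - y) = (ζ ^ i - 1) * α := by
    rw [hαdef] at hi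
    rw [map_add, map_mul, map_sub, map_one, hσζ, ← hαdef] at hi
    linear_combination hi + hαdef
  have h1 : ‖σ y - y‖ < 1 := by
    have e1 : ‖σ (y - z)‖ < 1 := by rwa [norm_aut]
    rw [map_sub, hσz] at e1
    have := norm_sub_lt' _ _ e1 hz
    simpa using this
  by_cases hd : p ∣ i
  · rw [(h.pow_eq_one_iff_dvd i).2 hd, sub_self, zero_mul, mul_eq_zero,
      or_iff_right (pi_ne h), sub_eq_zero] at hy
    exact hy
  · exfalso
    have h2 := congrArg norm hy
    rw [norm_mul, norm_mul, hα, mul_one, norm_zeta_pow_sub_one_of_not_dvd h hd] at h2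
    have := norm_pi_pos h
    nlinarith

lemma mem_of_fixed {k : Type*} [Field k] [Algebra k Ω] [Algebra.IsAlgebraic k Ω] [CharZero k]
    (E : IntermediateField k Ω)
    {x : Ω} (h : ∀ σ : Ω ≃ₐ[k] Ω, (∀ e ∈ E, σ e = e) → σ x = x) : x ∈ E := by
  have : IsAlgClosure E Ω := ⟨inferInstance, inferInstance⟩
  have : IsGalois E Ω := {}
  have h1 : x ∈ (⊥ : IntermediateField E Ω) := by
    rw [InfiniteGalois.mem_bot_iff_fixed]
    intro f
    exact h (f.restrictScalars k) (fun e he => f.commutes ⟨e, he⟩)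
  rw [IntermediateField.mem_bot] at h1
  obtain ⟨e, rfl⟩ := h1
  exact e.2

/-- Step E: `α^p ≡ 1 mod π^p` implies `α ∈ K(ζ_q)`. -/
lemma mem_of_close {ζ ζq : Ω} (h : IsPrimitiveRoot ζ p) (hq : IsPrimitiveRoot ζq (p ^ p - 1))
    (L : IntermediateField ℚ_[p] Ω) (hζL : ζ ∈ L) (hqL : ζq ∈ L) {α : Ω}
    (hα : α ^ p ∈ IntermediateField.adjoin ℚ_[p] {ζ}) (hα1 : ‖α ^ p - 1‖ ≤ ‖ζ - 1‖ ^ p) :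
    α ∈ L := by
  have hKL : IntermediateField.adjoin ℚ_[p] {ζ} ≤ L := by
    rw [IntermediateField.adjoin_le_iff]
    rintro _ rfl
    exact hζL
  have hπ := norm_pi_pos h
  have hζK := IntermediateField.mem_adjoin_simple_self ℚ_[p] ζ
  obtain ⟨y, rfl⟩ : ∃ y, α = 1 + (ζ - 1) * y := ⟨(α - 1) / (ζ - 1), by
    rw [mul_div_cancel₀ _ (pi_ne h)]; ring⟩
  have hy1 : ‖y‖ ≤ 1 := by
    have := norm_sub_one_le_of_pow h hα1
    rw [add_sub_cancel_left, norm_mul] at this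
    exact le_of_mul_le_mul_left (by simpa using this) hπ
  have hαn : ‖1 + (ζ - 1) * y‖ = 1 := by
    have e : ‖(ζ - 1) * y‖ < 1 := by
      rw [norm_mul]; exact mul_lt_one_of_nonneg_of_lt_one_left (norm_nonneg _) (norm_pi_lt h) hy1
    rw [IsUltrametricDist.norm_add_eq_max_of_norm_ne_norm (by rw [norm_one]; exact e.ne'),
      norm_one, max_eq_left e.le]
  obtain ⟨c, hc⟩ : ∃ c, (1 + (ζ - 1) * y) ^ p - 1 = (ζ - 1) ^ p * c :=
    ⟨((1 + (ζ - 1) * y) ^ p - 1) / (ζ - 1) ^ p, by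
      rw [mul_div_cancel₀ _ (pow_ne_zero _ (pi_ne h))]⟩
  have hcK : c ∈ IntermediateField.adjoin ℚ_[p] {ζ} := by
    have : c = ((1 + (ζ - 1) * y) ^ p - 1) / (ζ - 1) ^ p := by
      rw [hc, mul_div_cancel_left₀ _ (pow_ne_zero _ (pi_ne h))]
    rw [this]
    exact div_mem (sub_mem hα (one_mem _)) (pow_mem (sub_mem hζK (one_mem _)) _)
  have hc1 : ‖c‖ ≤ 1 := by
    rw [hc, norm_mul, norm_pow] at hα1
    exact le_of_mul_le_mul_left (by simpa using hα1) (pow_pos hπ p)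
  obtain ⟨n, hn⟩ := exists_int_close h hcK hc1
  have h1 : ‖y ^ p - y - n‖ < 1 := by
    have := norm_add_lt' _ _ (as_congr h hy1 hc) (hn.trans_lt (norm_pi_lt h))
    simpa using this
  obtain ⟨z, hz, hyz⟩ := exists_close_root hq (as_pow hy1 h1)
  have hzL : z ∈ L := by
    rcases hz with rfl | ⟨i, rfl⟩
    · exact zero_mem _
    · exact pow_mem hqL i
  apply mem_of_fixed
  intro σ hσ
  have := krasner h hαn hyz σ (hσ _ hζL) (hσ _ hzL) (hσ _ (hKL hα))
  rw [map_add, map_mul, map_sub, map_one, this, hσ _ hζL]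

/-- `ζ_q` lies in the Kummer extension generated by a `p`-th root of `1 + π^p`. -/
lemma zetaq_mem {ζ ζq : Ω} (h : IsPrimitiveRoot ζ p) (hq : IsPrimitiveRoot ζq (p ^ p - 1))
    (L : IntermediateField ℚ_[p] Ω) (hζL : ζ ∈ L) {α : Ω} (hαL : α ∈ L)
    (hα : α ^ p = 1 + (ζ - 1) ^ p) : ζq ∈ L := by
  have hπ := norm_pi_pos h
  have h1p : 1 < p ^ p := Nat.one_lt_pow hp.1.ne_zero hp.1.one_lt
  obtain ⟨y, rfl⟩ : ∃ y, α = 1 + (ζ - 1) * y := ⟨(α - 1) / (ζ - 1), by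
    rw [mul_div_cancel₀ _ (pi_ne h)]; ring⟩
  have hyL : y ∈ L := by
    have : y = (1 + (ζ - 1) * y - 1) / (ζ - 1) := by
      rw [add_sub_cancel_left, mul_div_cancel_left₀ _ (pi_ne h)]
    rw [this]
    exact div_mem (sub_mem hαL (one_mem _)) (sub_mem hζL (one_mem _))
  have hy1 : ‖y‖ ≤ 1 := by
    have := norm_sub_one_le_of_pow h (x := 1 + (ζ - 1) * y) (by rw [hα]; simp)
    rw [add_sub_cancel_left, norm_mul] at this
    exact le_of_mul_le_mul_left (by simpa using this) hπ
  have hcong := as_congr h hy1 (c := 1) (by rw [hα]; ring)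
  obtain ⟨O, k, _, _, r, hO, hr⟩ := exists_residue p
  let yo : O := ⟨y, (hO y).2 hy1⟩
  let zo : O := ⟨ζq, (hO ζq).2 (norm_root (by omega) hq.pow_eq_one).le⟩
  have e1 : r yo ^ p = r yo + 1 := by
    have := (hr (yo ^ p - yo - 1)).2 hcong
    rwa [map_sub, map_sub, map_pow, map_one, sub_sub, sub_eq_zero] at this
  have e2 : r zo ^ (p ^ p) = r zo := by
    rw [← map_pow]
    congr 1
    apply Subtype.ext
    change ζq ^ (p ^ p) = ζq
    conv_lhs => rw [← Nat.sub_add_cancel h1p.le, pow_succ, hq.pow_eq_one, one_mul]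
  obtain ⟨f, hf⟩ := exists_poly p k e1 e2
  have e3 : r (aeval yo f) = aeval (r yo) f := by
    have := hom_eval₂ f (algebraMap ℤ O) r yo
    rw [aeval_def, aeval_def, this]
    congr 1
    exact RingHom.ext_int _ _
  have e4 : ((aeval yo f : O) : Ω) = aeval y f := by
    have := hom_eval₂ f (algebraMap ℤ O) O.subtype yo
    rw [aeval_def, aeval_def]
    refine this.trans ?_
    congr 1
  have e5 : ‖ζq - aeval y f‖ < 1 := by
    have := (hr (zo - aeval yo f)).1 (by rw [map_sub, e3, hf, sub_self])
    rw [← e4]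
    exact this
  have hfL : aeval y f ∈ L := by
    rw [aeval_eq_sum_range]
    exact sum_mem fun i _ => zsmul_mem (pow_mem hyL i) _
  apply mem_of_fixed
  intro σ hσ
  have hζq0 : ζq ≠ 0 := hq.ne_zero (by omega)
  have e6 : ‖σ ζq - ζq‖ < 1 := by
    have e7 : ‖σ (ζq - aeval y f)‖ < 1 := by rwa [norm_aut]
    rw [map_sub, hσ _ hfL] at e7
    have := norm_sub_lt' _ _ e7 e5
    simpa using this
  have e8 := root_eq_one (μ := σ ζq / ζq) (N := p ^ p - 1) norm_q
    (by rw [div_pow, ← map_pow, hq.pow_eq_one, map_one, div_one])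
    (by
      rw [div_sub_one hζq0, norm_div, norm_root (by omega) hq.pow_eq_one, div_one]
      exact e6)
  exact (div_eq_one_iff_eq hζq0).1 e8

end LKW

namespace LKW

open Polynomial

variable {p : ℕ} [hp : Fact p.Prime]

local notation "Ω" => PadicAlgCl p

/-- `α` generates a Kummer extension on which `σ` acts through the cyclotomic character -/
def Eig (ζ : PadicAlgCl p) (σ : PadicAlgCl p ≃ₐ[ℚ_[p]] PadicAlgCl p) (g : ℕ)
    (α : PadicAlgCl p) : Prop :=
  α ≠ 0 ∧ α ^ p ∈ IntermediateField.adjoin ℚ_[p] {ζ} ∧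
    ∃ β ∈ IntermediateField.adjoin ℚ_[p] {ζ}, σ α = β * α ^ g

lemma aut_mem {ζ : Ω} {σ : Ω ≃ₐ[ℚ_[p]] Ω} {g : ℕ} (hσ : σ ζ = ζ ^ g) {b : Ω}
    (hb : b ∈ IntermediateField.adjoin ℚ_[p] {ζ}) : σ b ∈ IntermediateField.adjoin ℚ_[p] {ζ} := by
  have h1 : IntermediateField.adjoin ℚ_[p] {ζ} ≤
      (IntermediateField.adjoin ℚ_[p] {ζ}).comap (σ : Ω →ₐ[ℚ_[p]] Ω) := by
    rw [IntermediateField.adjoin_le_iff]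
    rintro _ rfl
    change σ _ ∈ IntermediateField.adjoin ℚ_[p] _
    rw [hσ]
    exact pow_mem (IntermediateField.mem_adjoin_simple_self _ _) _
  exact h1 hb

lemma Eig.mul {ζ : Ω} {σ : Ω ≃ₐ[ℚ_[p]] Ω} {g : ℕ} {α α' : Ω}
    (h : Eig ζ σ g α) (h' : Eig ζ σ g α') : Eig ζ σ g (α * α') := by
  obtain ⟨h1, h2, β, h3, h4⟩ := h
  obtain ⟨h1', h2', β', h3', h4'⟩ := h'
  refine ⟨mul_ne_zero h1 h1', ?_, β * β', mul_mem h3 h3', ?_⟩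
  · rw [mul_pow]; exact mul_mem h2 h2'
  · rw [map_mul, h4, h4']; ring

lemma Eig.of_mem {ζ : Ω} {σ : Ω ≃ₐ[ℚ_[p]] Ω} {g : ℕ} (hσ : σ ζ = ζ ^ g) {b : Ω} (hb0 : b ≠ 0)
    (hb : b ∈ IntermediateField.adjoin ℚ_[p] {ζ}) : Eig ζ σ g b := by
  refine ⟨hb0, pow_mem hb p, σ b / b ^ g, div_mem (aut_mem hσ hb) (pow_mem hb g), ?_⟩
  rw [div_mul_cancel₀ _ (pow_ne_zero _ hb0)]

lemma Eig.pow {ζ : Ω} {σ : Ω ≃ₐ[ℚ_[p]] Ω} {g : ℕ} (hσ : σ ζ = ζ ^ g) {α : Ω}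
    (h : Eig ζ σ g α) (n : ℕ) : Eig ζ σ g (α ^ n) := by
  induction n with
  | zero => rw [pow_zero]; exact Eig.of_mem hσ one_ne_zero (one_mem _)
  | succ n ih => rw [pow_succ]; exact ih.mul h

lemma Eig.root {ζ ζ2 : Ω} (hζ : IsPrimitiveRoot ζ p) {σ : Ω ≃ₐ[ℚ_[p]] Ω} {g : ℕ}
    (hσ : σ ζ = ζ ^ g) (h2 : ζ2 ^ p = ζ) : Eig ζ σ g ζ2 := by
  have h0 : ζ2 ≠ 0 := by
    rintro rfl
    rw [zero_pow hp.1.ne_zero] at h2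
    exact hζ.ne_zero hp.1.ne_zero h2.symm
  have hm := IntermediateField.mem_adjoin_simple_self ℚ_[p] ζ
  refine ⟨h0, by rw [h2]; exact hm, ?_⟩
  obtain ⟨i, hi⟩ := eq_zeta_pow_mul hp.1.pos hζ (a := σ ζ2) (b := ζ2 ^ g) (pow_ne_zero _ h0) (by
    rw [← map_pow, h2, hσ, ← h2]; ring)
  exact ⟨ζ ^ i, pow_mem hm i, hi⟩

lemma exists_gen (p : ℕ) [hp : Fact p.Prime] (hodd : Odd p) : ∃ g : ℕ, g.Coprime p ∧
    ¬ ((p : ℤ) ∣ g - 1) ∧ ∀ j, 2 ≤ j → j < p → ¬ ((p : ℤ) ∣ (g : ℤ) ^ j - g) := by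
  obtain ⟨u, hu⟩ := IsCyclic.exists_generator (α := (ZMod p)ˣ)
  have hord : orderOf u = p - 1 := by
    rw [orderOf_eq_card_of_forall_mem_zpowers hu, Nat.card_eq_fintype_card, ZMod.card_units]
  have h3 : 3 ≤ p := by
    obtain ⟨m, hm⟩ := hodd
    have := hp.1.two_le
    omega
  have hval : (((u : ZMod p).val : ℕ) : ZMod p) = (u : ZMod p) := by simp
  have key : ∀ j, 2 ≤ j → j < p → ¬ ((p : ℤ) ∣ ((u : ZMod p).val : ℤ) ^ j - (u : ZMod p).val) := by
    intro j hj1 hj2 hd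
    rw [← ZMod.intCast_zmod_eq_zero_iff_dvd] at hd
    push_cast at hd
    rw [hval, sub_eq_zero] at hd
    have h4 : u ^ (j - 1) = 1 := by
      have h5 : u ^ j = u := Units.ext (by simpa using hd)
      have h6 : u ^ (j - 1) * u = 1 * u := by
        rw [← pow_succ, Nat.sub_add_cancel (by omega), h5, one_mul]
      exact mul_right_cancel h6
    have h7 := orderOf_dvd_of_pow_eq_one h4
    rw [hord] at h7
    have := Nat.le_of_dvd (by omega) h7
    omega
  refine ⟨(u : ZMod p).val, ZMod.val_coe_unit_coprime u, ?_, key⟩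
  intro hd
  apply key 2 le_rfl (by omega)
  have : ((u : ZMod p).val : ℤ) ^ 2 - (u : ZMod p).val =
    (((u : ZMod p).val : ℤ) - 1) * (u : ZMod p).val := by ring
  rw [this]
  exact Dvd.dvd.mul_right hd _

lemma norm_eq_one_of_close {x : Ω} (h : ‖x - 1‖ < 1) : ‖x‖ = 1 := by
  have := IsUltrametricDist.norm_add_eq_max_of_norm_ne_norm (x := x - 1) (y := 1)
    (by rw [norm_one]; exact h.ne)
  rw [sub_add_cancel, norm_one, max_eq_right h.le] at this
  exact this

lemma norm_geom_sub {ζ : Ω} (hζ : ‖ζ‖ = 1) (g : ℕ) :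
    ‖∑ i ∈ Finset.range g, ζ ^ i - (g : Ω)‖ ≤ ‖ζ - 1‖ := by
  have : ∑ i ∈ Finset.range g, ζ ^ i - (g : Ω) = ∑ i ∈ Finset.range g, (ζ ^ i - 1) := by
    rw [Finset.sum_sub_distrib]; simp
  rw [this]
  exact IsUltrametricDist.norm_sum_le_of_forall_le_of_nonneg (norm_nonneg _) fun i _ =>
    norm_zeta_pow_sub_le hζ i

lemma norm_mul_sub_mul {a b c d : Ω} {r : ℝ} (hr : 0 ≤ r) (ha : ‖a‖ ≤ 1) (hd : ‖d‖ ≤ 1)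
    (hac : ‖a - c‖ ≤ r) (hbd : ‖b - d‖ ≤ r) : ‖a * b - c * d‖ ≤ r := by
  have : a * b - c * d = a * (b - d) + (a - c) * d := by ring
  rw [this]
  refine norm_add_le' _ _ ?_ ?_
  · rw [norm_mul]
    calc _ ≤ 1 * r := mul_le_mul ha hbd (norm_nonneg _) zero_le_one
      _ = r := one_mul r
  · rw [norm_mul]
    calc _ ≤ r * 1 := mul_le_mul hac hd (norm_nonneg _) hr
      _ = r := mul_one r

set_option maxHeartbeats 1000000 in
lemma eig_step {ζ : Ω} (hζ : IsPrimitiveRoot ζ p) {σ : Ω ≃ₐ[ℚ_[p]] Ω} {g : ℕ}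
    (hσ : σ ζ = ζ ^ g) {α : Ω} (h : Eig ζ σ g α) {j : ℕ} (hj2 : 2 ≤ j) (hjp : j < p)
    (hg : ¬ ((p : ℤ) ∣ (g : ℤ) ^ j - g)) (hα : ‖α ^ p - 1‖ ≤ ‖ζ - 1‖ ^ j) :
    ‖α ^ p - 1‖ ≤ ‖ζ - 1‖ ^ (j + 1) := by
  obtain ⟨hα0, hαK, β, hβK, hβ⟩ := h
  set ε := ‖ζ - 1‖ with hε
  have hε0 : 0 < ε := norm_pi_pos hζ
  have hε1 : ε < 1 := norm_pi_lt hζ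
  have hζn := norm_root hp.1.ne_zero hζ.pow_eq_one
  have hζK := IntermediateField.mem_adjoin_simple_self ℚ_[p] ζ
  have hπK : (ζ - 1) ^ j ∈ IntermediateField.adjoin ℚ_[p] {ζ} :=
    pow_mem (sub_mem hζK (one_mem _)) j
  have hπ0 : (ζ - 1) ^ j ≠ 0 := pow_ne_zero _ (pi_ne hζ)
  set a := α ^ p with ha
  obtain ⟨c, hc⟩ : ∃ c, a - 1 = (ζ - 1) ^ j * c := ⟨(a - 1) / (ζ - 1) ^ j, by
    rw [mul_div_cancel₀ _ hπ0]⟩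
  have hcK : c ∈ IntermediateField.adjoin ℚ_[p] {ζ} := by
    have : c = (a - 1) / (ζ - 1) ^ j := by
      rw [hc, mul_div_cancel_left₀ _ hπ0]
    rw [this]
    exact div_mem (sub_mem hαK (one_mem _)) hπK
  have hc1 : ‖c‖ ≤ 1 := by
    rw [hc, norm_mul, norm_pow] at hα
    exact le_of_mul_le_mul_left (by simpa using hα) (pow_pos hε0 j)
  obtain ⟨n, hn⟩ := exists_int_close hζ hcK hc1
  have hεj : ε ^ j ≤ ε := pow_le_of_le_one hε0.le hε1.le (by omega)
  have haε : ‖a - 1‖ ≤ ε := hα.trans hεj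
  have ha1 : ‖a‖ = 1 := norm_eq_one_of_close (haε.trans_lt hε1)
  -- the two expansions
  set e := ∑ i ∈ Finset.range g, ζ ^ i with he
  set s := ∑ i ∈ Finset.range g, a ^ i with hs
  have hσa : σ a - 1 = (ζ - 1) ^ j * (e ^ j * σ c) := by
    have : σ (a - 1) = (σ ζ - 1) ^ j * σ c := by
      rw [hc, map_mul, map_pow, map_sub, map_one]
    rw [map_sub, map_one, hσ, ← mul_geom_sum, ← he] at this
    rw [this, mul_pow]; ring
  have hag : a ^ g - 1 = (ζ - 1) ^ j * (c * s) := by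
    rw [← mul_geom_sum, ← hs, hc]; ring
  have heg : ‖e - g‖ ≤ ε := norm_geom_sub hζn g
  have hsg : ‖s - g‖ ≤ ε := (norm_geom_sub ha1 g).trans haε
  have he1 : ‖e‖ ≤ 1 := by
    have := norm_add_le' _ _ (heg.trans hε1.le) (norm_nat_le (p := p) g)
    simpa using this
  have hs1 : ‖s‖ ≤ 1 := by
    have := norm_add_le' _ _ (hsg.trans hε1.le) (norm_nat_le (p := p) g)
    simpa using this
  have hA : ‖e ^ j * σ c - (g : Ω) ^ j * (n : Ω)‖ ≤ ε := by
    refine norm_mul_sub_mul hε0.le ?_ (norm_nat_le n) ?_ ?_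
    · rw [norm_pow]; exact pow_le_one₀ (norm_nonneg _) he1
    · exact (norm_pow_sub_pow _ _ he1 (norm_nat_le g) j).trans heg
    · have : ‖σ (c - n)‖ ≤ ε := by rwa [norm_aut]
      rwa [map_sub, map_natCast] at this
  have hB : ‖c * s - (n : Ω) * (g : Ω)‖ ≤ ε := norm_mul_sub_mul hε0.le hc1 (norm_nat_le g) hn hsg
  have hA1 : ‖e ^ j * σ c‖ ≤ 1 := by
    rw [norm_mul, norm_pow, norm_aut]
    exact mul_le_one₀ (pow_le_one₀ (norm_nonneg _) he1) (norm_nonneg _) hc1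
  have hB1 : ‖c * s‖ ≤ 1 := by
    rw [norm_mul]
    exact mul_le_one₀ hc1 (norm_nonneg _) hs1
  have hdiff : σ a - a ^ g = (ζ - 1) ^ j * (e ^ j * σ c - c * s) := by
    linear_combination hσa - hag
  have hσa' : σ a = β ^ p * a ^ g := by
    rw [ha, map_pow, hβ]; ring
  have hβn : ‖β ^ p - 1‖ = ‖σ a - a ^ g‖ := by
    rw [hσa', ← sub_one_mul, norm_mul, norm_pow, ha1, one_pow, mul_one]
  have hβ1 : ‖β ^ p - 1‖ < 1 := by
    rw [hβn, hdiff, norm_mul, norm_pow]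
    calc _ ≤ ε ^ j * 1 := by
            refine mul_le_mul_of_nonneg_left (norm_sub_le' _ _ hA1 hB1) (by positivity)
      _ < 1 := by rw [mul_one]; exact hεj.trans_lt hε1
  have hβ2 : ‖β - 1‖ ≤ ε := norm_le_pi hζ (sub_mem hβK (one_mem _)) (norm_sub_one_lt hζ hβ1)
  have hβ3 := norm_pow_p_sub_one hζ hβ2
  rw [hβn, hdiff, norm_mul, norm_pow, ← hε] at hβ3
  have h5 : ‖e ^ j * σ c - c * s‖ ≤ ε := by
    have : ε ^ p ≤ ε ^ j * ε := by
      rw [← pow_succ]; exact pow_le_pow_of_le_one hε0.le hε1.le hjp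
    exact le_of_mul_le_mul_left (hβ3.trans this) (pow_pos hε0 j)
  have h6 : ‖((n * ((g : ℤ) ^ j - g) : ℤ) : Ω)‖ < 1 := by
    have e0 : ((n * ((g : ℤ) ^ j - g) : ℤ) : Ω) = (e ^ j * σ c - c * s) -
        (e ^ j * σ c - (g : Ω) ^ j * (n : Ω)) + (c * s - (n : Ω) * (g : Ω)) := by
      push_cast; ring
    rw [e0]
    exact (norm_add_le' _ _ (norm_sub_le' _ _ h5 hA) hB).trans_lt hε1
  rw [norm_int_lt_iff] at h6
  have h7 : (p : ℤ) ∣ n := ((Nat.prime_iff_prime_int.1 hp.1).dvd_or_dvd h6).resolve_right hg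
  have h8 : ‖(n : Ω)‖ ≤ ε := by
    have := norm_int_le_p (p := p) n ((norm_int_lt_iff _).2 h7)
    rw [Int.cast_natCast] at this
    exact this.trans (norm_p_le_pi hζ)
  have h9 : ‖c‖ ≤ ε := by
    have := norm_add_le' _ _ hn h8
    simpa using this
  rw [hc, norm_mul, norm_pow, pow_succ]
  exact mul_le_mul_of_nonneg_left h9 (by positivity)

lemma eig_close {ζ : Ω} (hζ : IsPrimitiveRoot ζ p) {σ : Ω ≃ₐ[ℚ_[p]] Ω} {g : ℕ}
    (hσ : σ ζ = ζ ^ g) {α : Ω} (h : Eig ζ σ g α)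
    (hg : ∀ j, 2 ≤ j → j < p → ¬ ((p : ℤ) ∣ (g : ℤ) ^ j - g)) (hα : ‖α ^ p - 1‖ ≤ ‖ζ - 1‖ ^ 2) :
    ‖α ^ p - 1‖ ≤ ‖ζ - 1‖ ^ p := by
  have : ∀ j, 2 ≤ j → j ≤ p → ‖α ^ p - 1‖ ≤ ‖ζ - 1‖ ^ j := by
    intro j hj
    induction j, hj using Nat.le_induction with
    | base => intro _; exact hα
    | succ j hj ih =>
      intro hjp
      exact eig_step hζ hσ h hj (by omega) (hg j hj (by omega)) (ih (by omega))
  exact this p hp.1.two_le le_rfl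

lemma eig_mem {ζ ζ2 ζq : Ω} (hζ : IsPrimitiveRoot ζ p) (h2 : ζ2 ^ p = ζ)
    (hq : IsPrimitiveRoot ζq (p ^ p - 1)) {σ : Ω ≃ₐ[ℚ_[p]] Ω} {g : ℕ}
    (hσ : σ ζ = ζ ^ g) {α : Ω} (h : Eig ζ σ g α) (hg1 : ¬ ((p : ℤ) ∣ g - 1))
    (hg : ∀ j, 2 ≤ j → j < p → ¬ ((p : ℤ) ∣ (g : ℤ) ^ j - g))
    (M : IntermediateField ℚ_[p] Ω) (h2M : ζ2 ∈ M) (hqM : ζq ∈ M) : α ∈ M := by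
  have hζM : ζ ∈ M := by rw [← h2]; exact pow_mem h2M p
  have hζK := IntermediateField.mem_adjoin_simple_self ℚ_[p] ζ
  have hKM : IntermediateField.adjoin ℚ_[p] {ζ} ≤ M := by
    rw [IntermediateField.adjoin_le_iff]
    rintro _ rfl
    exact hζM
  have hζn := norm_root hp.1.ne_zero hζ.pow_eq_one
  have hε0 : 0 < ‖ζ - 1‖ := norm_pi_pos hζ
  have hε1 : ‖ζ - 1‖ < 1 := norm_pi_lt hζ
  have h20 : ζ2 ≠ 0 := (Eig.root hζ hσ h2).1
  -- Case 3: `α ^ p ≡ 1 mod π`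
  have case3 : ∀ α : Ω, Eig ζ σ g α → ‖α ^ p - 1‖ < 1 → α ∈ M := by
    intro α hα hα1
    have hα2 := norm_le_pi hζ (sub_mem hα.2.1 (one_mem _)) hα1
    obtain ⟨c, hc⟩ : ∃ c, α ^ p - 1 = (ζ - 1) * c := ⟨(α ^ p - 1) / (ζ - 1), by
      rw [mul_div_cancel₀ _ (pi_ne hζ)]⟩
    have hcK : c ∈ IntermediateField.adjoin ℚ_[p] {ζ} := by
      have : c = (α ^ p - 1) / (ζ - 1) := by
        rw [hc, mul_div_cancel_left₀ _ (pi_ne hζ)]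
      rw [this]
      exact div_mem (sub_mem hα.2.1 (one_mem _)) (sub_mem hζK (one_mem _))
    have hc1 : ‖c‖ ≤ 1 := by
      rw [hc, norm_mul] at hα2
      exact le_of_mul_le_mul_left (by simpa using hα2) hε0
    obtain ⟨n, hn⟩ := exists_int_close hζ hcK hc1
    -- multiply by `ζ2 ^ m`, with `m ≡ -n`
    obtain ⟨m, hm⟩ : ∃ m : ℕ, p ∣ n + m := ⟨n * (p - 1), by
      refine ⟨n, ?_⟩
      obtain ⟨t, ht⟩ := Nat.exists_eq_succ_of_ne_zero hp.1.ne_zero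
      rw [ht]; simp; ring⟩
    have hE := hα.mul ((Eig.root hζ hσ h2).pow hσ m)
    set e := ∑ i ∈ Finset.range m, ζ ^ i with he
    have heg : ‖e - m‖ ≤ ‖ζ - 1‖ := norm_geom_sub hζn m
    have hζm : ζ ^ m = 1 + (ζ - 1) * e := by rw [he, mul_geom_sum]; ring
    have hpow : (α * ζ2 ^ m) ^ p - 1 = (ζ - 1) * ((c - n) + ζ ^ m * ((e - m) + (n + m : ℕ)) +
        (c * ((ζ ^ m) - 1) - (n : Ω) * (ζ ^ m - 1) - (e) * (ζ ^ m - 1))) := by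
      have e1 : (α * ζ2 ^ m) ^ p = α ^ p * ζ ^ m := by
        rw [mul_pow, ← h2]; ring
      rw [e1]
      push_cast
      linear_combination ζ ^ m * hc + hζm
    have hE2 : ‖(α * ζ2 ^ m) ^ p - 1‖ ≤ ‖ζ - 1‖ ^ 2 := by
      have hz := norm_zeta_pow_sub_le hζn m
      have hzm : ‖ζ ^ m‖ = 1 := by rw [norm_pow, hζn, one_pow]
      have he1 : ‖e‖ ≤ 1 := by
        have := norm_add_le' _ _ (heg.trans hε1.le) (norm_nat_le (p := p) m)
        simpa using this
      have aux : ∀ x : Ω, ‖x‖ ≤ 1 → ‖x * (ζ ^ m - 1)‖ ≤ ‖ζ - 1‖ := by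
        intro x hx
        rw [norm_mul]
        calc _ ≤ 1 * ‖ζ - 1‖ := mul_le_mul hx hz (norm_nonneg _) zero_le_one
          _ = _ := one_mul _
      have hnm : ‖((n + m : ℕ) : Ω)‖ ≤ ‖ζ - 1‖ := by
        have hd : (p : ℤ) ∣ ((n + m : ℕ) : ℤ) := by exact_mod_cast hm
        have := norm_int_le_p (p := p) _ ((norm_int_lt_iff _).2 hd)
        rw [Int.cast_natCast] at this
        exact this.trans (norm_p_le_pi hζ)
      rw [hpow, norm_mul, pow_two]
      refine mul_le_mul_of_nonneg_left ?_ hε0.le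
      refine norm_add_le' _ _ (norm_add_le' _ _ hn ?_) ?_
      · rw [norm_mul, hzm, one_mul]
        exact norm_add_le' _ _ heg hnm
      · exact norm_sub_le' _ _ (norm_sub_le' _ _ (aux _ hc1) (aux _ (norm_nat_le n))) (aux _ he1)
    have hmem := mem_of_close hζ hq M hζM hqM hE.2.1 (eig_close hζ hσ hE hg hE2)
    have : α = α * ζ2 ^ m / ζ2 ^ m := by rw [mul_div_cancel_right₀ _ (pow_ne_zero _ h20)]
    rw [this]
    exact div_mem hmem (pow_mem h2M m)
  -- Case 2: `‖α‖ = 1`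
  have case2 : ∀ α : Ω, Eig ζ σ g α → ‖α‖ = 1 → α ∈ M := by
    intro α hα hα1
    have hp1 : (p - 1) + 1 = p := Nat.sub_add_cancel hp.1.one_lt.le
    have hmem : α ^ (p - 1) ∈ M := by
      apply case3 _ (hα.pow hσ _)
      obtain ⟨n, hn⟩ := exists_int_close hζ hα.2.1 (by rw [norm_pow, hα1, one_pow])
      have hαp : ‖α ^ p‖ = 1 := by rw [norm_pow, hα1, one_pow]
      have hn1 : ‖(n : Ω)‖ = 1 := by
        refine le_antisymm (norm_nat_le n) (not_lt.1 fun hlt => ?_)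
        have := norm_add_lt' _ _ (hn.trans_lt hε1) hlt
        rw [sub_add_cancel, hαp] at this
        exact lt_irrefl _ this
      have hnp : ¬ (p : ℤ) ∣ n := by
        rw [← norm_int_lt_iff (p := p), Int.cast_natCast, hn1]; exact lt_irrefl _
      have hfer : ‖(n : Ω) ^ (p - 1) - 1‖ < 1 := by
        have h1 : (p : ℤ) ∣ (n : ℤ) ^ (p - 1) - 1 := by
          rw [← ZMod.intCast_zmod_eq_zero_iff_dvd]
          have h0 : (n : ZMod p) ≠ 0 := by
            intro h0
            apply hnp
            rw [← ZMod.intCast_zmod_eq_zero_iff_dvd]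
            simpa using h0
          push_cast
          rw [ZMod.pow_card_sub_one_eq_one h0, sub_self]
        rw [← norm_int_lt_iff] at h1
        simpa using h1
      have h3 : ‖(α ^ p) ^ (p - 1) - (n : Ω) ^ (p - 1)‖ < 1 :=
        (norm_pow_sub_pow _ _ hαp.le hn1.le _).trans_lt (hn.trans_lt hε1)
      have := norm_add_lt' _ _ h3 hfer
      rw [← pow_mul, mul_comm (p - 1), pow_mul]
      simpa using this
    have : α = α ^ p / α ^ (p - 1) := by
      rw [eq_div_iff (pow_ne_zero _ hα.1), ← pow_succ', hp1]
    rw [this]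
    exact div_mem (hKM hα.2.1) hmem
  -- Case 1: general
  obtain ⟨hα0, hαK, β, hβK, hβ⟩ := id h
  have hα0' : ‖α‖ ≠ 0 := norm_ne_zero_iff.2 hα0
  have hβ0 : β ≠ 0 := by
    rintro rfl
    rw [zero_mul] at hβ
    exact hα0 ((map_eq_zero σ).1 hβ)
  obtain ⟨a, ha⟩ := exists_norm_eq hζ hαK (pow_ne_zero _ hα0)
  obtain ⟨b, hb⟩ := exists_norm_eq hζ hβK hβ0
  obtain ⟨m, hm⟩ : ∃ m : ℤ, ‖α‖ = ‖ζ - 1‖ ^ m := by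
    have hcop : IsCoprime (p : ℤ) ((g : ℤ) - 1) :=
      (Nat.prime_iff_prime_int.1 hp.1).irreducible.coprime_iff_not_dvd.2 hg1
    obtain ⟨u, v, huv⟩ := hcop
    have e1 : ‖α‖ ^ (p : ℤ) = ‖ζ - 1‖ ^ a := by rw [zpow_natCast, ← norm_pow, ha]
    have e2 : ‖α‖ ^ ((g : ℤ) - 1) = ‖ζ - 1‖ ^ (-b) := by
      have := congrArg norm hβ
      rw [norm_aut, norm_mul, norm_pow, hb] at this
      rw [zpow_sub_one₀ hα0', zpow_natCast, zpow_neg]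
      rw [eq_comm, inv_eq_iff_eq_inv, mul_inv, inv_inv]
      field_simp
      linarith
    refine ⟨a * u + -b * v, ?_⟩
    rw [zpow_add₀ hε0.ne', zpow_mul, zpow_mul, ← e1, ← e2, ← zpow_mul, ← zpow_mul,
      ← zpow_add₀ hα0']
    have : (p : ℤ) * u + ((g : ℤ) - 1) * v = 1 := by linear_combination huv
    rw [this, zpow_one]
  have hπz : (ζ - 1) ^ (-m) ∈ IntermediateField.adjoin ℚ_[p] {ζ} :=
    zpow_mem (sub_mem hζK (one_mem _)) _
  have hπ0 : (ζ - 1) ^ (-m) ≠ 0 := zpow_ne_zero _ (pi_ne hζ)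
  have hmem := case2 _ (h.mul (Eig.of_mem hσ hπ0 hπz)) (by
    rw [norm_mul, norm_zpow, hm, ← zpow_add₀ hε0.ne', add_neg_cancel, zpow_zero])
  have : α = α * (ζ - 1) ^ (-m) / (ζ - 1) ^ (-m) := by rw [mul_div_cancel_right₀ _ hπ0]
  rw [this]
  exact div_mem hmem (hKM hπz)

end LKW

namespace LKW
open Polynomial
variable {p : ℕ} [hp : Fact p.Prime]
local notation "Ω" => PadicAlgCl p

lemma restr_comm (F : IntermediateField ℚ_[p] Ω) (hN : Normal ℚ_[p] F)
    (hcomm : ∀ σ τ : ↥F ≃ₐ[ℚ_[p]] ↥F, σ * τ = τ * σ) (τ σ : Ω ≃ₐ[ℚ_[p]] Ω) {α : Ω} (hα : α ∈ F) :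
    τ (σ α) = σ (τ α) := by
  have h := hcomm (τ.restrictNormal F) (σ.restrictNormal F)
  have h' := congrArg (algebraMap F Ω) (DFunLike.congr_fun h ⟨α, hα⟩)
  rw [AlgEquiv.mul_apply, AlgEquiv.mul_apply, AlgEquiv.restrictNormal_commutes,
    AlgEquiv.restrictNormal_commutes, AlgEquiv.restrictNormal_commutes,
    AlgEquiv.restrictNormal_commutes] at h'
  exact h'

lemma kummer_gen {ζ : Ω} (hζ : IsPrimitiveRoot ζ p) (k : Type*) [Field k] [Algebra k Ω]
    (hz : ζ ∈ Set.range (algebraMap k Ω)) (F : IntermediateField k Ω)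
    (hF : Module.finrank k F = p) (hG : IsGalois k F) :
    ∃ α : Ω, α ^ p ∈ Set.range (algebraMap k Ω) ∧ α ≠ 0 ∧ IntermediateField.adjoin k {α} = F := by
  have : FiniteDimensional k F := Module.finite_of_finrank_pos (by rw [hF]; exact hp.1.pos)
  have : IsCyclic (F ≃ₐ[k] F) := isCyclic_of_prime_card (p := p) (by
    rw [IsGalois.card_aut_eq_finrank, hF])
  have hroots : (primitiveRoots (Module.finrank k F) k).Nonempty := by
    rw [hF]
    obtain ⟨z, hz⟩ := hz
    refine ⟨z, ?_⟩
    rw [mem_primitiveRoots hp.1.pos]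
    rw [← hz] at hζ
    exact hζ.of_map_of_injective (f := algebraMap k Ω) (algebraMap k Ω).injective
  obtain ⟨α, ⟨a, ha⟩, hα⟩ := exists_root_adjoin_eq_top_of_isCyclic k F hroots
  rw [hF] at ha
  refine ⟨α, ⟨a, ?_⟩, ?_, ?_⟩
  · have := congrArg (algebraMap F Ω) ha
    rw [map_pow] at this
    exact this
  · intro h0
    have h0' : α = 0 := by simpa using h0
    rw [h0', IntermediateField.adjoin_zero] at hα
    have h1 : Module.finrank k F = 1 := by
      rw [← IntermediateField.finrank_top', ← hα, IntermediateField.finrank_bot]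
    rw [hF] at h1
    exact hp.1.one_lt.ne' h1
  · have := congrArg IntermediateField.lift hα
    rwa [IntermediateField.lift_adjoin_simple, IntermediateField.lift_top] at this

lemma part1_eig (hodd : Odd p) {ζ ζ2 ζq : Ω} (hζ : IsPrimitiveRoot ζ p) (h2 : ζ2 ^ p = ζ)
    (hq : IsPrimitiveRoot ζq (p ^ p - 1)) (K F M : IntermediateField ℚ_[p] Ω)
    (hK : K = IntermediateField.adjoin ℚ_[p] {ζ})
    (hG : Normal ℚ_[p] F) (hcomm : ∀ σ τ : ↥F ≃ₐ[ℚ_[p]] ↥F, σ * τ = τ * σ)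
    {α : Ω} (hαF : α ∈ F) (hα0 : α ≠ 0) (hαK : α ^ p ∈ K)
    (hM2 : ζ2 ∈ M) (hMq : ζq ∈ M) : α ∈ M := by
  have hζK : ζ ∈ K := by rw [hK]; exact IntermediateField.mem_adjoin_simple_self ℚ_[p] ζ
  obtain ⟨g, hg0, hg1, hg⟩ := exists_gen (p := p) hodd
  obtain ⟨σ, hσ⟩ := exists_aut hζ hg0
  have hζ0 : ζ ≠ 0 := hζ.ne_zero hp.1.ne_zero
  have hEig : Eig ζ σ g α := by
    refine ⟨hα0, hK ▸ hαK, σ α / α ^ g, ?_, ?_⟩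
    · apply mem_of_fixed
      intro τ hτ
      rw [← hK] at hτ
      have hτα : τ α ^ p = α ^ p := by
        rw [← map_pow]; exact hτ _ hαK
      obtain ⟨i, hi⟩ := eq_zeta_pow_mul hp.1.pos hζ hα0 hτα
      have hcom : τ (σ α) = σ (τ α) := restr_comm F hG hcomm τ σ hαF
      rw [map_div₀, map_pow, hcom, hi, map_mul, map_pow, hσ, mul_pow, ← pow_mul, ← pow_mul,
        mul_comm i g, mul_div_mul_left _ _ (pow_ne_zero _ hζ0)]
    · rw [div_mul_cancel₀ _ (pow_ne_zero _ hα0)]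
  exact eig_mem hζ h2 hq hσ hEig hg1 hg M hM2 hMq

lemma part1 (hodd : Odd p) {ζ ζ2 ζq : Ω} (hζ : IsPrimitiveRoot ζ p) (h2 : ζ2 ^ p = ζ)
    (hq : IsPrimitiveRoot ζq (p ^ p - 1)) (K : IntermediateField ℚ_[p] Ω)
    (hK : K = IntermediateField.adjoin ℚ_[p] {ζ}) (F : IntermediateField ↥K Ω)
    (hF : Module.finrank ↥K ↥F = p) (hG : IsGalois ℚ_[p] ↥F)
    (hcomm : ∀ σ τ : ↥F ≃ₐ[ℚ_[p]] ↥F, σ * τ = τ * σ) :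
    F ≤ IntermediateField.adjoin ↥K {ζ2, ζq} := by
  have hN : Normal ℚ_[p] (F.restrictScalars ℚ_[p]) := hG.to_normal
  have hζK : ζ ∈ K := by rw [hK]; exact IntermediateField.mem_adjoin_simple_self ℚ_[p] ζ
  have hGK : IsGalois K F := IsGalois.tower_top_of_isGalois ℚ_[p] K F
  obtain ⟨α, ⟨a, ha⟩, hα0, hα⟩ := kummer_gen hζ K ⟨⟨ζ, hζK⟩, rfl⟩ F hF hGK
  have hαF : α ∈ F := by rw [← hα]; exact IntermediateField.mem_adjoin_simple_self K α
  have h2M : ζ2 ∈ IntermediateField.adjoin ↥K {ζ2, ζq} :=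
    IntermediateField.subset_adjoin _ _ (by simp)
  have hqM : ζq ∈ IntermediateField.adjoin ↥K {ζ2, ζq} :=
    IntermediateField.subset_adjoin _ _ (by simp)
  have hαK : α ^ p ∈ K := by rw [← ha]; exact a.2
  have hmem : α ∈ IntermediateField.adjoin ↥K {ζ2, ζq} := by
    generalize IntermediateField.adjoin ↥K {ζ2, ζq} = M at *
    rw [← IntermediateField.mem_restrictScalars ℚ_[p]] at h2M hqM ⊢
    exact part1_eig hodd hζ h2 hq K (F.restrictScalars ℚ_[p]) _ hK hN hcomm hαF hα0 hαK h2M hqM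
  rw [← hα, IntermediateField.adjoin_le_iff]
  rintro _ rfl
  exact hmem

/-- Fields generated by roots of unity. -/
lemma cyc_galois {ζ x : Ω} {n : ℕ} (hζ : IsPrimitiveRoot ζ p) (hn : 0 < n) (hx : IsPrimitiveRoot x n)
    (K : IntermediateField ℚ_[p] Ω)
    (hK : K = IntermediateField.adjoin ℚ_[p] {ζ}) (F : IntermediateField ↥K Ω)
    (hF : F = IntermediateField.adjoin K {x}) :
    IsGalois ℚ_[p] ↥F ∧ ∀ σ τ : ↥F ≃ₐ[ℚ_[p]] ↥F, σ * τ = τ * σ := by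
  have hζK : ζ ∈ K := by rw [hK]; exact IntermediateField.mem_adjoin_simple_self ℚ_[p] ζ
  have hxF : x ∈ F := by rw [hF]; exact IntermediateField.mem_adjoin_simple_self K x
  have hζF : ζ ∈ F := F.algebraMap_mem ⟨ζ, hζK⟩
  have hR : F.restrictScalars ℚ_[p] = IntermediateField.adjoin ℚ_[p] {ζ, x} := by
    rw [hF]
    apply le_antisymm
    · have : (IntermediateField.adjoin K {x}).restrictScalars ℚ_[p] =
          K ⊔ IntermediateField.adjoin ℚ_[p] {x} := by
        rw [IntermediateField.restrictScalars_adjoin_eq_sup]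
      rw [this, hK]
      refine sup_le (IntermediateField.adjoin.mono _ _ _ (by simp)) (IntermediateField.adjoin.mono _ _ _ (by simp))
    · rw [IntermediateField.adjoin_le_iff, ← hF]
      rintro _ (rfl | rfl)
      · exact hζF
      · exact hxF
  have hpow : ∀ {m : ℕ} {y : Ω} (hy : IsPrimitiveRoot y m) (hm : 0 < m) (σ : Ω →ₐ[ℚ_[p]] Ω),
      ∃ i, σ y = y ^ i := by
    intro m y hy hm σ
    have : NeZero m := ⟨hm.ne'⟩
    obtain ⟨i, -, hi⟩ := hy.eq_pow_of_pow_eq_one (ξ := σ y) (by rw [← map_pow, hy.pow_eq_one, map_one])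
    exact ⟨i, hi.symm⟩
  have hnorm : Normal ℚ_[p] (F.restrictScalars ℚ_[p]) := by
    rw [IntermediateField.normal_iff_forall_map_le]
    intro σ
    rw [hR, IntermediateField.adjoin_map, IntermediateField.adjoin_le_iff]
    have hmem1 : ζ ∈ IntermediateField.adjoin ℚ_[p] {ζ, x} := IntermediateField.subset_adjoin _ _ (by simp)
    have hmem2 : x ∈ IntermediateField.adjoin ℚ_[p] {ζ, x} := IntermediateField.subset_adjoin _ _ (by simp)
    rintro _ ⟨y, (rfl | rfl), rfl⟩
    · obtain ⟨i, hi⟩ := hpow hζ hp.1.pos σ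
      simp only [SetLike.mem_coe]
      exact hi ▸ pow_mem hmem1 i
    · obtain ⟨i, hi⟩ := hpow hx hn σ
      exact hi ▸ pow_mem hmem2 i
  have : Normal ℚ_[p] F := hnorm
  refine ⟨{}, ?_⟩
  intro σ τ
  have key : ∀ y : Ω, ∀ hy : y ∈ IntermediateField.adjoin ℚ_[p] {ζ, x},
      ∀ hyF : y ∈ F, σ (τ ⟨y, hyF⟩) = τ (σ ⟨y, hyF⟩) := by
    have hp2 : ∀ {m : ℕ} {y : F} (hy : IsPrimitiveRoot y m) (hm : 0 < m) (σ : F ≃ₐ[ℚ_[p]] F),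
      ∃ i, σ y = y ^ i := by
      intro m y hy hm σ
      have : NeZero m := ⟨hm.ne'⟩
      obtain ⟨i, -, hi⟩ := hy.eq_pow_of_pow_eq_one (ξ := σ y) (by rw [← map_pow, hy.pow_eq_one, map_one])
      exact ⟨i, hi.symm⟩
    have hp3 : ∀ {m : ℕ} {y : F} (hy : IsPrimitiveRoot y m) (hm : 0 < m),
        σ (τ y) = τ (σ y) := by
      intro m y hy hm
      obtain ⟨i, hi⟩ := hp2 hy hm σ
      obtain ⟨j, hj⟩ := hp2 hy hm τ
      rw [hi, hj, map_pow, map_pow, hi, hj, ← pow_mul, ← pow_mul, mul_comm]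
    have hsub : ∀ y ∈ IntermediateField.adjoin ℚ_[p] {ζ, x}, y ∈ F := by
      intro y hy; rw [← hR] at hy; exact hy
    intro y hy hyF
    induction hy using IntermediateField.adjoin_induction with
    | mem y hy =>
      rcases hy with rfl | rfl
      · exact hp3 (m := p) (IsPrimitiveRoot.of_map_of_injective (f := algebraMap F Ω) hζ
          (algebraMap F Ω).injective) hp.1.pos
      · exact hp3 (m := n) (IsPrimitiveRoot.of_map_of_injective (f := algebraMap F Ω) hx
          (algebraMap F Ω).injective) hn
    | algebraMap y =>
      have : (⟨algebraMap ℚ_[p] Ω y, hyF⟩ : F) = algebraMap ℚ_[p] F y := rfl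
      rw [this]; simp
    | add u v hu hv ihu ihv =>
      have : (⟨u + v, hyF⟩ : F) = ⟨u, hsub u hu⟩ + ⟨v, hsub v hv⟩ := rfl
      rw [this, map_add, map_add, map_add, map_add, ihu, ihv]
    | inv u hu ihu =>
      have : (⟨u⁻¹, hyF⟩ : F) = (⟨u, hsub u hu⟩)⁻¹ := rfl
      rw [this, map_inv₀, map_inv₀, map_inv₀, map_inv₀, ihu]
    | mul u v hu hv ihu ihv =>
      have : (⟨u * v, hyF⟩ : F) = ⟨u, hsub u hu⟩ * ⟨v, hsub v hv⟩ := rfl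
      rw [this, map_mul, map_mul, map_mul, map_mul, ihu, ihv]
  ext ⟨y, hy⟩
  have hy' : y ∈ IntermediateField.adjoin ℚ_[p] {ζ, x} := by rw [← hR]; exact hy
  rw [AlgEquiv.mul_apply, AlgEquiv.mul_apply, key y hy' hy]

end LKW

namespace LKW
open Polynomial
variable {p : ℕ} [hp : Fact p.Prime]
local notation "Ω" => PadicAlgCl p

lemma group_equiv (G : Type*) [Group G] (hcomm : ∀ a b : G, a * b = b * a)
    (hexp : ∀ a : G, a ^ p = 1) (hcard : Nat.card G = p ^ 2) :
    Nonempty (G ≃* Multiplicative (ZMod p) × Multiplicative (ZMod p)) := by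
  let : CommGroup G := { (inferInstance : Group G) with mul_comm := hcomm }
  let : Module (ZMod p) (Additive G) := AddCommGroup.zmodModule (n := p) (G := Additive G)
    (fun x => congrArg Additive.ofMul (hexp x.toMul))
  have hfin : Finite (Additive G) := Nat.finite_of_card_ne_zero (by
    change Nat.card G ≠ 0
    rw [hcard]; exact pow_ne_zero _ hp.1.ne_zero)
  have hfr : Module.finrank (ZMod p) (Additive G) = 2 := by
    have h1 := Module.natCard_eq_pow_finrank (K := ZMod p) (V := Additive G)
    have h2 : Nat.card (Additive G) = p ^ 2 := hcard
    rw [h2, Nat.card_zmod] at h1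
    exact (Nat.pow_right_injective hp.1.two_le h1).symm
  have e : Additive G ≃ₗ[ZMod p] (ZMod p × ZMod p) := LinearEquiv.ofFinrankEq _ _ (by
    rw [hfr]; simp)
  exact ⟨{ toFun := fun x => (Multiplicative.ofAdd (e (Additive.ofMul x)).1,
             Multiplicative.ofAdd (e (Additive.ofMul x)).2)
           invFun := fun y => (e.symm (y.1.toAdd, y.2.toAdd)).toMul
           left_inv := fun x => by simp
           right_inv := fun y => by simp
           map_mul' := fun x y => by simp }⟩

lemma kummer_deg (k : Type*) [Field k] [Algebra k Ω] {ζ x : Ω} (hζ : IsPrimitiveRoot ζ p)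
    (hz : ζ ∈ Set.range (algebraMap k Ω)) (ha : x ^ p ∈ Set.range (algebraMap k Ω))
    (hx : x ∉ Set.range (algebraMap k Ω)) :
    Module.finrank k (IntermediateField.adjoin k {x}) = p := by
  obtain ⟨a, ha⟩ := ha
  obtain ⟨z, hz⟩ := hz
  have hirr : Irreducible (X ^ p - C a) := by
    rw [X_pow_sub_C_irreducible_iff_of_prime hp.1]
    intro b hb
    have hb' : x ^ p = (algebraMap k Ω b) ^ p := by rw [← ha, ← hb, map_pow]
    have hb0 : algebraMap k Ω b ≠ 0 := by
      intro h0
      rw [h0, zero_pow hp.1.ne_zero] at hb'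
      apply hx
      rw [eq_zero_of_pow_eq_zero hb']
      exact ⟨0, map_zero _⟩
    obtain ⟨i, hi⟩ := eq_zeta_pow_mul hp.1.pos hζ hb0 hb'
    exact hx ⟨z ^ i * b, by rw [map_mul, map_pow, hz, hi]⟩
  have hroot : aeval x (X ^ p - C a : k[X]) = 0 := by simp [ha]
  have hmp := minpoly.eq_of_irreducible_of_monic hirr hroot (monic_X_pow_sub_C a hp.1.ne_zero)
  have hintegral : IsIntegral k x := ⟨_, monic_X_pow_sub_C a hp.1.ne_zero, by
    rw [← aeval_def]; exact hroot⟩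
  rw [IntermediateField.adjoin.finrank hintegral, ← hmp, natDegree_X_pow_sub_C]

/-- if `γ ∈ k(α)`, then `γ = b α ^ m`. -/
lemma kummer_mem (k : Type*) [Field k] [Algebra k Ω] [Algebra.IsAlgebraic k Ω] [CharZero k]
    {ζ α γ : Ω} (hζ : IsPrimitiveRoot ζ p)
    (hz : ζ ∈ Set.range (algebraMap k Ω)) (ha : α ^ p ∈ Set.range (algebraMap k Ω))
    (hα : α ∉ Set.range (algebraMap k Ω)) (hc : γ ^ p ∈ Set.range (algebraMap k Ω))
    (hγ0 : γ ≠ 0) (hγ : γ ∈ IntermediateField.adjoin k {α}) :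
    ∃ m : ℕ, ∃ b ∈ Set.range (algebraMap k Ω), γ = b * α ^ m := by
  have hdeg := kummer_deg k hζ hz ha hα
  have hα0 : α ≠ 0 := by
    rintro rfl
    exact hα ⟨0, map_zero _⟩
  obtain ⟨τ, hτ⟩ : ∃ τ : Ω ≃ₐ[k] Ω, τ α ≠ α := by
    by_contra! hcon
    have : α ∈ (⊥ : IntermediateField k Ω) := mem_of_fixed _ fun σ _ => hcon σ
    exact hα (IntermediateField.mem_bot.1 this)
  have hτz : τ ζ = ζ := by
    obtain ⟨z, rfl⟩ := hz; exact τ.commutes z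
  have hpw : ∀ x : Ω, x ≠ 0 → x ^ p ∈ Set.range (algebraMap k Ω) → ∃ i, τ x = ζ ^ i * x := by
    intro x hx0 hx
    apply eq_zeta_pow_mul hp.1.pos hζ hx0
    obtain ⟨y, hy⟩ := hx
    rw [← map_pow, ← hy, τ.commutes]
  obtain ⟨i, hi⟩ := hpw α hα0 ha
  obtain ⟨j, hj⟩ := hpw γ hγ0 hc
  have hpi : ¬ p ∣ i := by
    rintro ⟨t, rfl⟩
    rw [pow_mul, hζ.pow_eq_one, one_pow, one_mul] at hi
    exact hτ hi
  obtain ⟨m, hm⟩ : ∃ m : ℕ, ζ ^ (i * m) = ζ ^ j := by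
    have h0 : (i : ZMod p) ≠ 0 := by
      rwa [Ne, ZMod.natCast_eq_zero_iff]
    refine ⟨((j : ZMod p) / i).val, ?_⟩
    rw [← pow_mod_orderOf ζ (i * _), ← pow_mod_orderOf ζ j, ← hζ.eq_orderOf]
    congr 1
    refine (ZMod.natCast_eq_natCast_iff' _ _ _).1 ?_
    push_cast
    rw [ZMod.natCast_val, ZMod.cast_id', id, mul_div_cancel₀ _ h0]
  refine ⟨m, γ / α ^ m, ?_, by field_simp⟩
  have hb : γ / α ^ m ∈ IntermediateField.adjoin k {α} :=
    div_mem hγ (pow_mem (IntermediateField.mem_adjoin_simple_self k α) m)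
  have hfix : τ (γ / α ^ m) = γ / α ^ m := by
    have hζ0 : ζ ≠ 0 := hζ.ne_zero hp.1.ne_zero
    rw [map_div₀, map_pow, hi, hj, mul_pow, ← pow_mul, hm]
    field_simp
  by_contra hbk
  have hle : IntermediateField.adjoin k {γ / α ^ m} ≤ IntermediateField.adjoin k {α} := by
    rw [IntermediateField.adjoin_le_iff]; rintro _ rfl; exact hb
  have hbp : (γ / α ^ m) ^ p ∈ Set.range (algebraMap k Ω) := by
    obtain ⟨u, hu⟩ := ha
    obtain ⟨v, hv⟩ := hc
    exact ⟨v / u ^ m, by rw [map_div₀, map_pow, hu, hv]; ring⟩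
  have hdeg' := kummer_deg k hζ hz hbp hbk
  have : FiniteDimensional k (IntermediateField.adjoin k {α}) :=
    Module.finite_of_finrank_pos (by rw [hdeg]; exact hp.1.pos)
  have heq := IntermediateField.eq_of_le_of_finrank_eq hle (hdeg'.trans hdeg.symm)
  have hαb : α ∈ IntermediateField.adjoin k {γ / α ^ m} := by
    rw [heq]; exact IntermediateField.mem_adjoin_simple_self k α
  apply hτ
  have : ∀ y ∈ IntermediateField.adjoin k {γ / α ^ m}, τ y = y := by
    intro y hy
    induction hy using IntermediateField.adjoin_induction with
    | mem y hy => rw [Set.mem_singleton_iff.1 hy, hfix]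
    | algebraMap y => exact τ.commutes y
    | add u v hu hv ihu ihv => rw [map_add, ihu, ihv]
    | inv u hu ihu => rw [map_inv₀, ihu]
    | mul u v hu hv ihu ihv => rw [map_mul, ihu, ihv]
  exact this α hαb

lemma kummer_two (k : Type*) [Field k] [Algebra k Ω] [Algebra.IsAlgebraic k Ω] [CharZero k]
    {ζ α γ : Ω} (hζ : IsPrimitiveRoot ζ p)
    (hz : ζ ∈ Set.range (algebraMap k Ω)) (ha : α ^ p ∈ Set.range (algebraMap k Ω))
    (hα : α ∉ Set.range (algebraMap k Ω)) (hc : γ ^ p ∈ Set.range (algebraMap k Ω))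
    (hγ0 : γ ≠ 0) (hγ : γ ∉ IntermediateField.adjoin k {α}) (M : IntermediateField k Ω)
    (hM : M = IntermediateField.adjoin k {α, γ}) :
    Nonempty ((M ≃ₐ[k] M) ≃* Multiplicative (ZMod p) × Multiplicative (ZMod p)) := by
  have hdeg := kummer_deg k hζ hz ha hα
  have hα0 : α ≠ 0 := by
    rintro rfl
    exact hα ⟨0, map_zero _⟩
  have hdeg2 : Module.finrank k M = p ^ 2 := by
    have h1 : Module.finrank (IntermediateField.adjoin k {α})
        (IntermediateField.adjoin (IntermediateField.adjoin k {α}) {γ}) = p := by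
      obtain ⟨z, hz⟩ := hz
      obtain ⟨c, hc⟩ := hc
      refine kummer_deg _ hζ ⟨algebraMap k _ z, hz⟩ ⟨algebraMap k _ c, hc⟩ ?_
      rintro ⟨y, hy⟩
      exact hγ (hy ▸ y.2)
    have h2 := Module.finrank_mul_finrank k (IntermediateField.adjoin k {α})
        (IntermediateField.adjoin (IntermediateField.adjoin k {α}) {γ})
    rw [hM, ← IntermediateField.adjoin_simple_adjoin_simple, pow_two]
    rw [hdeg, h1] at h2
    exact h2.symm
  have : FiniteDimensional k M := Module.finite_of_finrank_pos (by
    rw [hdeg2]; exact pow_pos hp.1.pos _)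
  have hζM : ∀ i, ζ ^ i ∈ M := by
    intro i
    obtain ⟨z, rfl⟩ := hz; exact pow_mem (M.algebraMap_mem z) i
  have hpw : ∀ x : Ω, x ≠ 0 → x ^ p ∈ Set.range (algebraMap k Ω) → ∀ τ : Ω →ₐ[k] Ω,
      ∃ i, τ x = ζ ^ i * x := by
    intro x hx0 hx τ
    apply eq_zeta_pow_mul hp.1.pos hζ hx0
    obtain ⟨y, hy⟩ := hx
    rw [← map_pow, ← hy, τ.commutes]
  have hαM : α ∈ M := by rw [hM]; exact IntermediateField.subset_adjoin _ _ (by simp)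
  have hγM : γ ∈ M := by rw [hM]; exact IntermediateField.subset_adjoin _ _ (by simp)
  have : IsAlgClosure k Ω := ⟨inferInstance, inferInstance⟩
  have hnorm : Normal k M := by
    rw [IntermediateField.normal_iff_forall_map_le]
    intro σ
    nth_rw 1 [hM]
    rw [IntermediateField.adjoin_map, IntermediateField.adjoin_le_iff]
    rintro _ ⟨y, hy, rfl⟩
    rcases hy with hy | hy
    · rw [hy]
      obtain ⟨i, hi⟩ := hpw α hα0 ha σ
      have := mul_mem (hζM i) hαM
      rw [← hi] at this
      exact this
    · rw [Set.mem_singleton_iff.1 hy]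
      obtain ⟨i, hi⟩ := hpw γ hγ0 hc σ
      have := mul_mem (hζM i) hγM
      rw [← hi] at this
      exact this
  have hgal : IsGalois k M := {}
  obtain ⟨z, hz⟩ := hz
  have hzp : z ^ p = 1 := by
    apply (algebraMap k Ω).injective
    rw [map_pow, hz, hζ.pow_eq_one, map_one]
  -- action on generators
  have hact : ∀ y : Ω, ∀ hy : y ∈ M, y ≠ 0 → y ^ p ∈ Set.range (algebraMap k Ω) →
      ∀ σ : M ≃ₐ[k] M, ∃ i, σ ⟨y, hy⟩ = algebraMap k M z ^ i * ⟨y, hy⟩ := by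
    intro y hy hy0 hyp σ
    have : ((σ ⟨y, hy⟩ : M) : Ω) ^ p = y ^ p := by
      obtain ⟨c, hc⟩ := hyp
      have h1 : (⟨y, hy⟩ : M) ^ p = algebraMap k M c := Subtype.ext hc.symm
      have h2 : σ ⟨y, hy⟩ ^ p = algebraMap k M c := by rw [← map_pow, h1, σ.commutes]
      rw [← hc]
      exact congrArg Subtype.val h2
    obtain ⟨i, hi⟩ := eq_zeta_pow_mul hp.1.pos hζ hy0 this
    refine ⟨i, Subtype.ext ?_⟩
    rw [hi, ← hz]
    rfl
  have hgen : ∀ y ∈ ({α, γ} : Set Ω), ∃ hy : y ∈ M, ∀ σ : M ≃ₐ[k] M,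
      ∃ i, σ ⟨y, hy⟩ = algebraMap k M z ^ i * ⟨y, hy⟩ := by
    intro y hy
    rcases hy with hy | hy
    · subst hy; exact ⟨hαM, hact _ hαM hα0 ha⟩
    · have := Set.mem_singleton_iff.1 hy
      subst this; exact ⟨hγM, hact _ hγM hγ0 hc⟩
  have hext : ∀ σ τ : M ≃ₐ[k] M, (∀ y (_ : y ∈ ({α, γ} : Set Ω)) (hy : y ∈ M),
      σ ⟨y, hy⟩ = τ ⟨y, hy⟩) → σ = τ := by
    intro σ τ h
    have : (σ : M →ₐ[k] M) = τ :=
      IntermediateField.algHom_ext_of_eq_adjoin _ hM fun y hy => h y hy _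
    exact AlgEquiv.coe_toAlgHom_injective this
  apply group_equiv
  · intro σ τ
    apply hext
    intro y hyS hy
    obtain ⟨_, h⟩ := hgen y hyS
    obtain ⟨i, hi⟩ := h σ
    obtain ⟨j, hj⟩ := h τ
    rw [AlgEquiv.mul_apply, AlgEquiv.mul_apply, hi, hj, map_mul, map_mul, map_pow, map_pow,
      σ.commutes, τ.commutes, hi, hj]
    ring
  · intro σ
    apply hext
    intro y hyS hy
    obtain ⟨_, h⟩ := hgen y hyS
    obtain ⟨i, hi⟩ := h σ
    have : ∀ n : ℕ, (σ ^ n) ⟨y, hy⟩ = (algebraMap k M z ^ i) ^ n * ⟨y, hy⟩ := by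
      intro n
      induction n with
      | zero => simp
      | succ n ih =>
        rw [pow_succ', AlgEquiv.mul_apply, ih, map_mul, map_pow, map_pow, σ.commutes, hi]
        ring
    rw [this, ← pow_mul, mul_comm i, pow_mul, ← map_pow, hzp, map_one, one_pow, one_mul]
    rfl
  · rw [IsGalois.card_aut_eq_finrank, hdeg2]

end LKW

namespace LKW
open Polynomial
variable {p : ℕ} [hp : Fact p.Prime]
local notation "Ω" => PadicAlgCl p

lemma alpha_not_mem {ζ α : Ω} (hζ : IsPrimitiveRoot ζ p) (hα : α ^ p = 1 + (ζ - 1) ^ p) :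
    α ∉ IntermediateField.adjoin ℚ_[p] {ζ} := by
  intro hαK
  have hζK := IntermediateField.mem_adjoin_simple_self ℚ_[p] ζ
  have hε0 : 0 < ‖ζ - 1‖ := norm_pi_pos hζ
  have hε1 : ‖ζ - 1‖ < 1 := norm_pi_lt hζ
  have h1 : ‖α - 1‖ ≤ ‖ζ - 1‖ := by
    apply norm_sub_one_le_of_pow hζ
    rw [hα, add_sub_cancel_left, norm_pow]
  have hyK : (α - 1) / (ζ - 1) ∈ IntermediateField.adjoin ℚ_[p] {ζ} :=
    div_mem (sub_mem hαK (one_mem _)) (sub_mem hζK (one_mem _))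
  have hy1 : ‖(α - 1) / (ζ - 1)‖ ≤ 1 := by
    rw [norm_div]; exact div_le_one_of_le₀ h1 hε0.le
  have hαy : α = 1 + (ζ - 1) * ((α - 1) / (ζ - 1)) := by
    rw [mul_div_cancel₀ _ (pi_ne hζ)]; ring
  generalize (α - 1) / (ζ - 1) = y at *
  have has : ‖y ^ p - y - 1‖ < 1 := by
    apply as_congr hζ hy1
    rw [← hαy, hα]; ring
  obtain ⟨n, hn⟩ := exists_int_close hζ hyK hy1
  have hnlt : ‖y - n‖ < 1 := hn.trans_lt hε1
  have h2 : ‖y ^ p - (n : Ω) ^ p‖ < 1 :=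
    (norm_pow_sub_pow _ _ hy1 (norm_nat_le n) _).trans_lt hnlt
  have h3 : ‖(n : Ω) ^ p - (n : Ω)‖ < 1 := by
    have hd : (p : ℤ) ∣ (n : ℤ) ^ p - n := by
      rw [← ZMod.intCast_zmod_eq_zero_iff_dvd]
      push_cast
      rw [ZMod.pow_card, sub_self]
    rw [← norm_int_lt_iff] at hd
    simpa using hd
  have h4 := norm_sub_lt' _ _ (norm_sub_lt' _ _ (norm_add_lt' _ _ h2 h3) hnlt) has
  have e : y ^ p - (n : Ω) ^ p + ((n : Ω) ^ p - n) - (y - n) - (y ^ p - y - 1) = 1 := by ring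
  rw [e, norm_one] at h4
  exact lt_irrefl _ h4

lemma zeta_ne {ζ α b : Ω} (hζ : IsPrimitiveRoot ζ p) (hα : α ^ p = 1 + (ζ - 1) ^ p)
    (hb : b ∈ IntermediateField.adjoin ℚ_[p] {ζ}) (m : ℕ) : ζ ≠ (b * α ^ m) ^ p := by
  intro h
  have hε0 : 0 < ‖ζ - 1‖ := norm_pi_pos hζ
  have hε1 : ‖ζ - 1‖ < 1 := norm_pi_lt hζ
  have hlt : ‖ζ - 1‖ ^ p < ‖ζ - 1‖ := pow_lt_self_of_lt_one₀ hε0 hε1 hp.1.one_lt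
  have hα1 : ‖α ^ p - 1‖ ≤ ‖ζ - 1‖ ^ p := by
    rw [hα, add_sub_cancel_left, norm_pow]
  have hαn : ‖α ^ p‖ = 1 := norm_eq_one_of_close (hα1.trans_lt (hlt.trans hε1))
  have hu : ‖(α ^ p) ^ m - 1‖ ≤ ‖ζ - 1‖ ^ p := by
    have := norm_pow_sub_pow (α ^ p) 1 hαn.le norm_one.le m
    rw [one_pow] at this
    exact this.trans hα1
  have hun : ‖(α ^ p) ^ m‖ = 1 := by rw [norm_pow, hαn, one_pow]
  have e : (b ^ p - 1) * (α ^ p) ^ m = (ζ - 1) - ((α ^ p) ^ m - 1) := by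
    nth_rw 1 [h]; ring
  have h1 : ‖b ^ p - 1‖ < 1 := by
    have := norm_sub_lt' _ _ hε1 (hu.trans_lt (hlt.trans hε1))
    rwa [← e, norm_mul, hun, mul_one] at this
  have h2 := norm_pow_p_sub_one hζ
    (norm_le_pi hζ (sub_mem hb (one_mem _)) (norm_sub_one_lt hζ h1))
  have h3 : ‖(b ^ p - 1) * (α ^ p) ^ m + ((α ^ p) ^ m - 1)‖ ≤ ‖ζ - 1‖ ^ p := by
    refine norm_add_le' _ _ ?_ hu
    rwa [norm_mul, hun, mul_one]
  rw [e, sub_add_cancel] at h3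
  exact absurd h3 (not_le.2 hlt)

lemma main (hodd : Odd p) {ζ ζ2 ζq : Ω} (hζ : IsPrimitiveRoot ζ p)
    (hζ2 : IsPrimitiveRoot ζ2 (p ^ 2)) (h2 : ζ2 ^ p = ζ)
    (hq : IsPrimitiveRoot ζq (p ^ p - 1)) (K : IntermediateField ℚ_[p] Ω)
    (hK : K = IntermediateField.adjoin ℚ_[p] {ζ}) :
    (∀ F : IntermediateField ↥K Ω,
      Module.finrank ↥K ↥F = p → IsGalois ℚ_[p] ↥F →
      (∀ σ τ : ↥F ≃ₐ[ℚ_[p]] ↥F, σ * τ = τ * σ) →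
      F ≤ IntermediateField.adjoin ↥K {ζ2, ζq}) ∧
    sSup {F : IntermediateField ↥K Ω |
        Module.finrank ↥K ↥F = p ∧ IsGalois ℚ_[p] ↥F ∧
        ∀ σ τ : ↥F ≃ₐ[ℚ_[p]] ↥F, σ * τ = τ * σ}
      = IntermediateField.adjoin ↥K {ζ2, ζq} ∧
    Nonempty ((↥(IntermediateField.adjoin ↥K {ζ2, ζq}) ≃ₐ[↥K]
        ↥(IntermediateField.adjoin ↥K {ζ2, ζq})) ≃*
      Multiplicative (ZMod p) × Multiplicative (ZMod p)) := by
  have hP1 := part1 hodd hζ h2 hq K hK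
  have hζK : ζ ∈ K := by rw [hK]; exact IntermediateField.mem_adjoin_simple_self ℚ_[p] ζ
  have hrange : ∀ x : Ω, x ∈ Set.range (algebraMap K Ω) ↔ x ∈ K := fun x =>
    ⟨by rintro ⟨y, rfl⟩; exact y.2, fun hx => ⟨⟨x, hx⟩, rfl⟩⟩
  obtain ⟨α, hα⟩ := IsAlgClosed.exists_pow_nat_eq (1 + (ζ - 1) ^ p : Ω) hp.1.pos
  have hζr : ζ ∈ Set.range (algebraMap K Ω) := (hrange _).2 hζK
  have hαpK : α ^ p ∈ K := by
    rw [hα]; exact add_mem (one_mem _) (pow_mem (sub_mem hζK (one_mem _)) _)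
  have hαp : α ^ p ∈ Set.range (algebraMap K Ω) := (hrange _).2 hαpK
  have hαn : α ∉ Set.range (algebraMap K Ω) := by
    rw [hrange, hK]; exact alpha_not_mem hζ hα
  have h2p : ζ2 ^ p ∈ Set.range (algebraMap K Ω) := by rw [h2]; exact hζr
  have h20 : ζ2 ≠ 0 := hζ2.ne_zero (pow_ne_zero _ hp.1.ne_zero)
  have h2n : ζ2 ∉ IntermediateField.adjoin K {α} := by
    intro hmem
    obtain ⟨m, b, hb, hbm⟩ := kummer_mem K hζ hζr hαp hαn h2p h20 hmem
    rw [hrange, hK] at hb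
    refine zeta_ne hζ hα hb m ?_
    rw [← hbm, h2]
  have hLq : IntermediateField.adjoin K {α} = IntermediateField.adjoin K {ζq} := by
    apply le_antisymm
    · rw [IntermediateField.adjoin_le_iff]
      rintro _ rfl
      have m1 : ζ ∈ (IntermediateField.adjoin K {ζq}).restrictScalars ℚ_[p] :=
        (IntermediateField.adjoin K {ζq}).algebraMap_mem ⟨ζ, hζK⟩
      have m2 : ζq ∈ (IntermediateField.adjoin K {ζq}).restrictScalars ℚ_[p] :=
        IntermediateField.mem_adjoin_simple_self K ζq
      exact mem_of_close hζ hq _ m1 m2 (hK ▸ hαpK) (by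
        rw [hα, add_sub_cancel_left, norm_pow])
    · rw [IntermediateField.adjoin_le_iff]
      rintro _ rfl
      have m1 : ζ ∈ (IntermediateField.adjoin K {α}).restrictScalars ℚ_[p] :=
        (IntermediateField.adjoin K {α}).algebraMap_mem ⟨ζ, hζK⟩
      have m2 : α ∈ (IntermediateField.adjoin K {α}).restrictScalars ℚ_[p] :=
        IntermediateField.mem_adjoin_simple_self K α
      exact zetaq_mem hζ hq _ m1 m2 hα
  have hpp : 0 < p ^ p - 1 := Nat.sub_pos_of_lt (Nat.one_lt_pow hp.1.ne_zero hp.1.one_lt)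
  refine ⟨hP1, le_antisymm ?_ ?_, ?_⟩
  · exact sSup_le fun F hF => hP1 F hF.1 hF.2.1 hF.2.2
  · rw [IntermediateField.adjoin_le_iff]
    intro y hy
    rcases hy with hy | hy
    · rw [hy]
      have hd : Module.finrank K (IntermediateField.adjoin K {ζ2}) = p := by
        apply kummer_deg K hζ hζr h2p
        rintro ⟨z, hz⟩
        exact h2n (hz ▸ (IntermediateField.adjoin K {α}).algebraMap_mem z)
      have hmem := cyc_galois hζ (pow_pos hp.1.pos 2) hζ2 K hK _ rfl
      refine (le_sSup ?_ : IntermediateField.adjoin K {ζ2} ≤ _)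
        (IntermediateField.mem_adjoin_simple_self K ζ2)
      exact ⟨hd, hmem.1, hmem.2⟩
    · rw [Set.mem_singleton_iff.1 hy]
      have hd : Module.finrank K (IntermediateField.adjoin K {ζq}) = p := by
        rw [← hLq]
        exact kummer_deg K hζ hζr hαp hαn
      have hmem := cyc_galois hζ hpp hq K hK _ rfl
      refine (le_sSup ?_ : IntermediateField.adjoin K {ζq} ≤ _)
        (IntermediateField.mem_adjoin_simple_self K ζq)
      exact ⟨hd, hmem.1, hmem.2⟩
  · refine kummer_two K hζ hζr hαp hαn h2p h20 h2n _ ?_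
    have e1 : IntermediateField.adjoin K {ζ2, ζq} =
        IntermediateField.adjoin K {ζ2} ⊔ IntermediateField.adjoin K {ζq} := by
      rw [← IntermediateField.adjoin_union]; rfl
    have e2 : IntermediateField.adjoin K {α, ζ2} =
        IntermediateField.adjoin K {α} ⊔ IntermediateField.adjoin K {ζ2} := by
      rw [← IntermediateField.adjoin_union]; rfl
    rw [e1, e2, hLq, sup_comm]

lemma K_eq {ζ ζp : Ω} (hζ : IsPrimitiveRoot ζ p) (hζp : IsPrimitiveRoot ζp p) :
    IntermediateField.adjoin ℚ_[p] {ζp} = IntermediateField.adjoin ℚ_[p] {ζ} := by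
  have : NeZero p := ⟨hp.1.ne_zero⟩
  have key : ∀ {x y : Ω}, IsPrimitiveRoot x p → IsPrimitiveRoot y p →
      IntermediateField.adjoin ℚ_[p] {x} ≤ IntermediateField.adjoin ℚ_[p] {y} := by
    intro x y hx hy
    rw [IntermediateField.adjoin_le_iff]
    rintro _ rfl
    obtain ⟨i, -, rfl⟩ := hy.eq_pow_of_pow_eq_one hx.pow_eq_one
    exact pow_mem (IntermediateField.mem_adjoin_simple_self ℚ_[p] y) i
  exact le_antisymm (key hζp hζ) (key hζ hζp)

end LKW

/-- Let `p` be an odd prime and `K = ℚ_p(ζ_p)` inside a fixed algebraic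
closure. The compositum of all degree-`p` extensions `F` of `K` such that `F/ℚ_p` is abelian
Galois equals `ℚ_p(ζ_{p²}, ζ_{p^p - 1})`; in particular every such `F` is contained in it, and
its Galois group over `K` is `C_p × C_p`. -/
theorem stmt14 (p : ℕ) [hp : Fact p.Prime] (hodd : Odd p)
    (ζp ζp2 ζq : AlgebraicClosure ℚ_[p])
    (hζp : IsPrimitiveRoot ζp p) (hζp2 : IsPrimitiveRoot ζp2 (p ^ 2))
    (hζq : IsPrimitiveRoot ζq (p ^ p - 1))
    (K : IntermediateField ℚ_[p] (AlgebraicClosure ℚ_[p]))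
    (hK : K = IntermediateField.adjoin ℚ_[p] {ζp}) :
    (∀ F : IntermediateField ↥K (AlgebraicClosure ℚ_[p]),
      Module.finrank ↥K ↥F = p → IsGalois ℚ_[p] ↥F →
      (∀ σ τ : ↥F ≃ₐ[ℚ_[p]] ↥F, σ * τ = τ * σ) →
      F ≤ IntermediateField.adjoin ↥K {ζp2, ζq}) ∧
    sSup {F : IntermediateField ↥K (AlgebraicClosure ℚ_[p]) |
        Module.finrank ↥K ↥F = p ∧ IsGalois ℚ_[p] ↥F ∧
        ∀ σ τ : ↥F ≃ₐ[ℚ_[p]] ↥F, σ * τ = τ * σ}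
      = IntermediateField.adjoin ↥K {ζp2, ζq} ∧
    Nonempty ((↥(IntermediateField.adjoin ↥K {ζp2, ζq}) ≃ₐ[↥K]
        ↥(IntermediateField.adjoin ↥K {ζp2, ζq})) ≃*
      Multiplicative (ZMod p) × Multiplicative (ZMod p)) := by
  have hζ : IsPrimitiveRoot (ζp2 ^ p) p :=
    hζp2.pow (pow_pos hp.1.pos 2) (pow_two p)
  exact LKW.main hodd hζ hζp2 rfl hζq K (hK.trans (LKW.K_eq hζ hζp))
end

section
/- The field Q_2(i) (where i^2 = −1) is not contained in any Galois extension F/Q_2 of degree 4 whose Galois group is cyclic of order 4. -/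
theorem aux_int (a b : ℚ_[2]) (h : a ^ 2 + b ^ 2 = -1) (ha : ‖a‖ ≤ 1) : False := by
  have hb : ‖b‖ ≤ 1 := by
    have h1 : b ^ 2 = -1 - a ^ 2 := by linear_combination h
    have h2 : ‖b ^ 2‖ ≤ 1 := by
      rw [h1, sub_eq_add_neg]
      refine (Padic.nonarchimedean _ _).trans (max_le ?_ ?_)
      · simp
      · rw [norm_neg, norm_pow]
        exact pow_le_one₀ (norm_nonneg _) ha
    rw [norm_pow] at h2
    by_contra hc
    push Not at hc
    nlinarith
  obtain ⟨x, hx⟩ : ∃ x : ℤ_[2], (x : ℚ_[2]) = a := ⟨⟨a, ha⟩, rfl⟩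
  obtain ⟨y, hy⟩ : ∃ y : ℤ_[2], (y : ℚ_[2]) = b := ⟨⟨b, hb⟩, rfl⟩
  have hz : x ^ 2 + y ^ 2 = -1 := by
    apply Subtype.ext
    push_cast
    rw [hx, hy]
    exact h
  have h4 := congrArg (PadicInt.toZModPow (p := 2) 2) hz
  simp only [map_add, map_pow, map_neg, map_one] at h4
  generalize PadicInt.toZModPow (p := 2) 2 x = u at h4
  generalize PadicInt.toZModPow (p := 2) 2 y = v at h4
  clear hz hx hy
  revert u v
  decide

theorem aux_sq (a b : ℚ_[2]) (h : a ^ 2 + b ^ 2 = -1) : False := by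
  rcases le_or_gt ‖a‖ 1 with ha | ha
  · exact aux_int a b h ha
  · have ha0 : a ≠ 0 := by
      rintro rfl
      simp at ha
      linarith
    refine aux_int a⁻¹ (b / a) ?_ ?_
    · field_simp
      linear_combination h
    · rw [norm_inv]
      exact inv_le_one_of_one_le₀ ha.le

/-- `ℚ₂(i)` (with `i² = -1`) is not contained in any Galois extension of
`ℚ₂` of degree `4` whose Galois group is cyclic (of order `4`). -/
theorem stmt15 (i : AlgebraicClosure ℚ_[2]) (hi : i ^ 2 = -1) :
    ¬ ∃ F : IntermediateField ℚ_[2] (AlgebraicClosure ℚ_[2]),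
      i ∈ F ∧ Module.finrank ℚ_[2] ↥F = 4 ∧ IsGalois ℚ_[2] ↥F ∧
      IsCyclic (↥F ≃ₐ[ℚ_[2]] ↥F) := by
  rintro ⟨F, hiF, hdim, hgal, hcyc⟩
  have hfd : FiniteDimensional ℚ_[2] F := Module.finite_of_finrank_pos (by omega)
  obtain ⟨j, hj⟩ : ∃ j : F, j ^ 2 = -1 := ⟨⟨i, hiF⟩, Subtype.ext (by push_cast; exact hi)⟩
  obtain ⟨σ, hσ⟩ := hcyc.exists_generator
  have hord : orderOf σ = 4 := by
    rw [orderOf_eq_card_of_forall_mem_zpowers hσ, IsGalois.card_aut_eq_finrank, hdim]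
  have hfix : ∀ x : F, σ x = x → ∃ a : ℚ_[2], algebraMap ℚ_[2] F a = x := by
    intro x hx
    have := (IsGalois.mem_range_algebraMap_iff_fixed (F := ℚ_[2]) x).2 (by
      intro f
      have hs : σ ∈ MulAction.stabilizer (F ≃ₐ[ℚ_[2]] F) x := hx
      exact (Subgroup.zpowers_le.2 hs) (hσ f))
    exact this
  have hj0 : j ≠ 0 := by
    rintro rfl
    norm_num at hj
  have hinj := (algebraMap ℚ_[2] F).injective
  have hσj : σ j = -j := by
    have h1 : (σ j) ^ 2 = j ^ 2 := by rw [← map_pow, hj]; simp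
    rcases sq_eq_sq_iff_eq_or_eq_neg.1 h1 with h | h
    · obtain ⟨a, ha⟩ := hfix j h
      exfalso
      refine aux_sq a 0 (hinj ?_)
      simp [ha, hj]
    · exact h
  have hσ4 : ∀ x, σ (σ (σ (σ x))) = x := by
    intro x
    have : (σ ^ 4) x = x := by rw [← hord, pow_orderOf_eq_one]; rfl
    exact this
  obtain ⟨z, hz⟩ : ∃ z, σ (σ z) ≠ z := by
    by_contra hc
    push Not at hc
    have h2 : σ ^ 2 = 1 := AlgEquiv.ext hc
    have := orderOf_dvd_of_pow_eq_one h2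
    rw [hord] at this
    norm_num at this
  obtain ⟨y, hy0, hy⟩ : ∃ y : F, y ≠ 0 ∧ σ (σ y) = -y :=
    ⟨σ (σ z) - z, sub_ne_zero.2 hz, by simp [hσ4]⟩
  have hsy0 : σ y ≠ 0 := by simpa using hy0
  obtain ⟨w, hw⟩ : ∃ w, w = σ y / y := ⟨_, rfl⟩
  have hsw : σ w = -y / σ y := by rw [hw, map_div₀, hy]
  have hssw : σ (σ w) = w := by
    rw [hsw, map_div₀, hy, map_neg, hw, neg_div_neg_eq]
  have hn : w * σ w = -1 := by
    rw [hsw, hw]; field_simp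
  have h2 : σ 2 = 2 := map_ofNat σ 2
  obtain ⟨a, ha⟩ := hfix ((w + σ w) / 2) (by rw [map_div₀, map_add, hssw, h2, add_comm])
  obtain ⟨b, hb⟩ := hfix ((w - σ w) / (2 * j)) (by
    rw [map_div₀, map_sub, hssw, map_mul, h2, hσj]
    field_simp
    ring)
  refine aux_sq a b (hinj ?_)
  rw [map_add, map_pow, map_pow, ha, hb, div_pow, div_pow, mul_pow, hj, map_neg, map_one]
  linear_combination hn
end
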